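/- Fix an integer r ≥ 3, reals ε > 0 and K ≥ 1. For every σ > 0 there exist δ > 0 and n₀ such that for every n ≥ n₀ divisible by r, every integer m with (1+ε)(n/r)·log n < m ≤ C(n,r), and every m-edge r-graph H on [n]: if H satisfies A(δ) and R(δ,K), then H satisfies E(σ). -/

import Mathlib

open Finset

/-- The set of perfect matchings of the `r`-graph `G` on vertex set `W`. -/
def pmSet (W : Finset ℕ) (G : Finset (Finset ℕ)) : Finset (Finset (Finset ℕ)) :=
  G.powerset.filter (fun M => (∀ A ∈ M, ∀ B ∈ M, A ≠ B → A ∩ B = ∅) ∧ M.biUnion id = W)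

/-- The number of perfect matchings of `G` (denoted `Φ(G)`). -/
def pmCount (W : Finset ℕ) (G : Finset (Finset ℕ)) : ℕ := (pmSet W G).card

/-- All `r`-element subsets of `[n]`. -/
def Kn (n r : ℕ) : Finset (Finset ℕ) := Finset.powersetCard r (Finset.range n)

/-- `G − Z`: the set of edges of `G` disjoint from `Z`. -/
def minus (G : Finset (Finset ℕ)) (Z : Finset ℕ) : Finset (Finset ℕ) :=
  G.filter (fun A => A ∩ Z = ∅)

/-- `Φ(G − Z)`, with `G − Z` regarded as an `r`-graph on `W \ Z`. -/
def phiSub (W : Finset ℕ) (G : Finset (Finset ℕ)) (Z : Finset ℕ) : ℕ :=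
  pmCount (W \ Z) (minus G Z)

/-- Degree of `x` in `G`. -/
def deg (G : Finset (Finset ℕ)) (x : ℕ) : ℕ := (G.filter (fun A => x ∈ A)).card

/-- Codegree of `x, y` in `G`. -/
def codeg (G : Finset (Finset ℕ)) (x y : ℕ) : ℕ :=
  (G.filter (fun A => x ∈ A ∧ y ∈ A)).card

/-- Average degree `D_G = r|G|/|W|`. -/
noncomputable def avgDeg (r : ℕ) (W : Finset ℕ) (G : Finset (Finset ℕ)) : ℝ :=
  ((r : ℝ) * G.card) / W.card

/-- Property `R(δ,K)`: all but at most `δ|W|` vertices have degree `(1±δ)D_G`,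
every degree lies in `[D_G/K, K·D_G]`, and all codegrees are at most `δ·D_G`. -/
def propR (r : ℕ) (W : Finset ℕ) (G : Finset (Finset ℕ)) (δ K : ℝ) : Prop :=
  ((W.filter (fun x =>
      ¬((1 - δ) * avgDeg r W G ≤ (deg G x : ℝ) ∧
        (deg G x : ℝ) ≤ (1 + δ) * avgDeg r W G))).card : ℝ) ≤ δ * W.card ∧
  (∀ x ∈ W, (deg G x : ℝ) ≤ K * avgDeg r W G ∧ avgDeg r W G / K ≤ (deg G x : ℝ)) ∧
  ∀ x ∈ W, ∀ y ∈ W, x ≠ y → (codeg G x y : ℝ) ≤ δ * avgDeg r W G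

/-- Property `E(σ)`: all but at most `σ|G|` edges `A` satisfy
`Φ(G−A) = (1±σ)Φ(G)/D_G`. -/
def propE (r : ℕ) (W : Finset ℕ) (G : Finset (Finset ℕ)) (σ : ℝ) : Prop :=
  ((G.filter (fun A =>
      ¬((1 - σ) * (pmCount W G : ℝ) / avgDeg r W G ≤ (phiSub W G A : ℝ) ∧
        (phiSub W G A : ℝ) ≤ (1 + σ) * (pmCount W G : ℝ) / avgDeg r W G))).card : ℝ) ≤
    σ * G.card

/-- Property `F(σ)`: all but at most `σ·C(|W|,r)` of the `r`-subsets `U` of `W`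
satisfy `Φ(G−U) = (1±σ)Φ(G)/D_G`. -/
def propF (r : ℕ) (W : Finset ℕ) (G : Finset (Finset ℕ)) (σ : ℝ) : Prop :=
  (((Finset.powersetCard r W).filter (fun U =>
      ¬((1 - σ) * (pmCount W G : ℝ) / avgDeg r W G ≤ (phiSub W G U : ℝ) ∧
        (phiSub W G U : ℝ) ≤ (1 + σ) * (pmCount W G : ℝ) / avgDeg r W G))).card : ℝ) ≤
    σ * (W.card.choose r)

/-- Property `C(δ,σ)`: for every `r`-subset `Z` of `W` with
`Φ(G−Z) ≥ Φ(G)e^{−δ|W|}` and every `x ∈ Z`, all but at most `σ|W|` vertices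
`y ∈ W∖Z` satisfy `Φ(G−((Z∖{x})∪{y})) ≥ (1−σ)·Φ(G−Z)·d_G(x)/D_G`. -/
def propC (r : ℕ) (W : Finset ℕ) (G : Finset (Finset ℕ)) (δ σ : ℝ) : Prop :=
  ∀ Z ∈ Finset.powersetCard r W,
    (pmCount W G : ℝ) * Real.exp (-δ * W.card) ≤ (phiSub W G Z : ℝ) →
    ∀ x ∈ Z,
      (((W \ Z).filter (fun y =>
          ¬((1 - σ) * (phiSub W G Z : ℝ) * (deg G x : ℝ) / avgDeg r W G ≤
            (phiSub W G (insert y (Z.erase x)) : ℝ)))).card : ℝ) ≤ σ * W.card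

/-- Property `B(C)`: `Φ(G−A) ≤ C·Φ(G)/D_G` for every edge `A ∈ G`. -/
def propB (r : ℕ) (W : Finset ℕ) (G : Finset (Finset ℕ)) (C : ℝ) : Prop :=
  ∀ A ∈ G, (phiSub W G A : ℝ) ≤ C * (pmCount W G : ℝ) / avgDeg r W G

/-- Property `A(δ)` for an `r`-graph `H` on `[n]` with `m` edges:
`log Φ(H) > log Φ₀ − ∑_{i=1}^{t} γ_i − δn`, where `t = C(n,r) − m`,
`γ_i = (n/r)/(C(n,r)−i+1)`, and `Φ₀ = n!/((n/r)!·(r!)^{n/r})`. -/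
def propA (r n : ℕ) (H : Finset (Finset ℕ)) (δ : ℝ) : Prop :=
  Real.log ((n.factorial : ℝ) /
      ((Nat.factorial (n / r) : ℝ) * (Nat.factorial r : ℝ) ^ (n / r)))
    - (∑ i ∈ Finset.Icc 1 (n.choose r - H.card),
        ((n : ℝ) / r) / ((n.choose r : ℝ) - (i : ℝ) + 1))
    - δ * n < Real.log (pmCount (Finset.range n) H)

lemma mem_pmSet {W : Finset ℕ} {G M : Finset (Finset ℕ)} : M ∈ pmSet W G ↔
    M ⊆ G ∧ (∀ A ∈ M, ∀ B ∈ M, A ≠ B → A ∩ B = ∅) ∧ M.biUnion id = W := by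
  simp [pmSet]

lemma pm_eq_of_mem {W : Finset ℕ} {G M : Finset (Finset ℕ)} (hM : M ∈ pmSet W G)
    {A B : Finset ℕ} (hA : A ∈ M) (hB : B ∈ M) {x : ℕ} (hxA : x ∈ A) (hxB : x ∈ B) : A = B := by
  by_contra h
  have := (mem_pmSet.1 hM).2.1 A hA B hB h
  have h2 : x ∈ A ∩ B := mem_inter.2 ⟨hxA, hxB⟩
  rw [this] at h2
  simp at h2

lemma pm_subset {W : Finset ℕ} {G M : Finset (Finset ℕ)} (hM : M ∈ pmSet W G)
    {A : Finset ℕ} (hA : A ∈ M) : A ⊆ W := by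
  rw [← (mem_pmSet.1 hM).2.2]
  exact subset_biUnion_of_mem id hA

lemma pm_cover {W : Finset ℕ} {G M : Finset (Finset ℕ)} (hM : M ∈ pmSet W G)
    {x : ℕ} (hx : x ∈ W) : ∃ A ∈ M, x ∈ A := by
  rw [← (mem_pmSet.1 hM).2.2] at hx
  simpa using hx

/-- Matchings of `G` through the edge `A` correspond to matchings of `G - A`. -/
lemma pm_sum_through (W : Finset ℕ) (G : Finset (Finset ℕ)) (A : Finset ℕ) (hA : A ∈ G)
    (hAW : A ⊆ W) (hne : A.Nonempty) (F : Finset (Finset ℕ) → ℝ) :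
    ∑ M ∈ (pmSet W G).filter (fun M => A ∈ M), F M
      = ∑ M ∈ pmSet (W \ A) (minus G A), F (insert A M) := by
  symm
  have hnot : ∀ M ∈ pmSet (W \ A) (minus G A), A ∉ M := by
    intro M hM hAM
    have h1 := (mem_pmSet.1 hM).1 hAM
    simp only [minus, mem_filter, inter_self] at h1
    exact hne.ne_empty h1.2
  refine Finset.sum_bij' (fun M _ => insert A M) (fun M _ => M.erase A) ?_ ?_ ?_ ?_ ?_
  · intro M hM
    obtain ⟨h1, h2, h3⟩ := mem_pmSet.1 hM
    have hd : ∀ B ∈ M, B ∩ A = ∅ := fun B hB => (mem_filter.1 (h1 hB)).2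
    rw [mem_filter, mem_pmSet]
    refine ⟨⟨?_, ?_, ?_⟩, mem_insert_self _ _⟩
    · intro B hB
      rcases mem_insert.1 hB with rfl | hB
      · exact hA
      · exact (mem_filter.1 (h1 hB)).1
    · intro B hB C hC hBC
      rcases mem_insert.1 hB with rfl | hB' <;> rcases mem_insert.1 hC with rfl | hC'
      · exact absurd rfl hBC
      · rw [inter_comm]; exact hd C hC'
      · exact hd B hB'
      · exact h2 B hB' C hC' hBC
    · rw [biUnion_insert, h3]
      simp [union_sdiff_of_subset hAW]
  · intro M hM
    obtain ⟨hM, hAM⟩ := mem_filter.1 hM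
    obtain ⟨h1, h2, h3⟩ := mem_pmSet.1 hM
    rw [mem_pmSet]
    refine ⟨?_, ?_, ?_⟩
    · intro B hB
      obtain ⟨hBA, hB⟩ := mem_erase.1 hB
      exact mem_filter.2 ⟨h1 hB, h2 B hB A hAM hBA⟩
    · intro B hB C hC hBC
      exact h2 B (mem_of_mem_erase hB) C (mem_of_mem_erase hC) hBC
    · ext x
      rw [← h3]
      simp only [mem_biUnion, mem_erase, id, mem_sdiff]
      constructor
      · rintro ⟨B, ⟨hBA, hB⟩, hx⟩
        refine ⟨⟨B, hB, hx⟩, fun hxA => hBA (pm_eq_of_mem hM hB hAM hx hxA)⟩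
      · rintro ⟨⟨B, hB, hx⟩, hxA⟩
        refine ⟨B, ⟨?_, hB⟩, hx⟩
        rintro rfl
        exact hxA hx
  · intro M hM
    exact erase_insert (hnot M hM)
  · intro M hM
    exact insert_erase (mem_filter.1 hM).2
  · intro M hM
    rfl

/-- Total available weight at `v`. -/
noncomputable def Nv (G : Finset (Finset ℕ)) (w : Finset ℕ → ℝ) (κ : ℕ → ℕ)
    (M : Finset (Finset ℕ)) (v : ℕ) : ℝ :=
  ∑ A ∈ G.filter (fun A => v ∈ A ∧ ∀ B ∈ M, (∃ u ∈ B, κ u < κ v) → A ∩ B = ∅), w A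

/-- Vertices that come first in their matching edge. -/
def Fs (W : Finset ℕ) (κ : ℕ → ℕ) (M : Finset (Finset ℕ)) : Finset ℕ :=
  W.filter (fun v => ∃ B ∈ M, v ∈ B ∧ ∀ u ∈ B, κ v ≤ κ u)

lemma Nv_nonneg (G : Finset (Finset ℕ)) (w : Finset ℕ → ℝ) (hw : ∀ A, 0 < w A) (κ : ℕ → ℕ)
    (M : Finset (Finset ℕ)) (v : ℕ) : 0 ≤ Nv G w κ M v :=
  Finset.sum_nonneg fun A _ => (hw A).le

lemma greedy (w : Finset ℕ → ℝ) (hw : ∀ A, 0 < w A) (κ : ℕ → ℕ) :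
    ∀ (c : ℕ) (W : Finset ℕ) (G : Finset (Finset ℕ)), W.card ≤ c →
    (∀ A ∈ G, A ⊆ W ∧ A.Nonempty) → Set.InjOn κ W →
    ∑ M ∈ pmSet W G, (∏ B ∈ M, w B) / (∏ v ∈ Fs W κ M, Nv G w κ M v) ≤ 1 := by
  intro c
  induction c with
  | zero =>
    intro W G hc hG _
    have hW : W = ∅ := by simpa using hc
    subst hW
    have : pmSet ∅ G ⊆ {∅} := by
      intro M hM
      have h := mem_pmSet.1 hM
      rw [mem_singleton, Finset.eq_empty_iff_forall_notMem]
      intro A hA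
      obtain ⟨h1, h2⟩ := hG A (h.1 hA)
      rw [subset_empty] at h1
      exact h2.ne_empty h1
    refine (Finset.sum_le_sum_of_subset_of_nonneg this ?_).trans ?_
    · intro M _ _
      apply div_nonneg
      · exact prod_nonneg fun A _ => (hw A).le
      · exact prod_nonneg fun A _ => Nv_nonneg _ _ hw _ _ _
    · simp [Fs]
  | succ c ih =>
    intro W G hc hG hκ
    rcases W.eq_empty_or_nonempty with hW | hW
    · exact ih W G (by simp [hW]) hG hκ
    obtain ⟨v0, hv0, hmin⟩ := W.exists_min_image κ hW
    set T : ℝ := ∑ A ∈ G.filter (fun A => v0 ∈ A), w A with hT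
    have hnn : ∀ M, 0 ≤ (∏ B ∈ M, w B) / (∏ v ∈ Fs W κ M, Nv G w κ M v) := by
      intro M
      apply div_nonneg
      · exact prod_nonneg fun A _ => (hw A).le
      · exact prod_nonneg fun A _ => Nv_nonneg _ _ hw _ _ _
    have step1 : ∑ M ∈ pmSet W G, (∏ B ∈ M, w B) / (∏ v ∈ Fs W κ M, Nv G w κ M v)
        ≤ ∑ A ∈ G.filter (fun A => v0 ∈ A), ∑ M ∈ (pmSet W G).filter (fun M => A ∈ M),
          (∏ B ∈ M, w B) / (∏ v ∈ Fs W κ M, Nv G w κ M v) := by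
      have hr : ∀ A ∈ G.filter (fun A => v0 ∈ A), ∑ M ∈ (pmSet W G).filter (fun M => A ∈ M),
          (∏ B ∈ M, w B) / (∏ v ∈ Fs W κ M, Nv G w κ M v) = ∑ M ∈ pmSet W G, if A ∈ M then
          (∏ B ∈ M, w B) / (∏ v ∈ Fs W κ M, Nv G w κ M v) else 0 :=
        fun A _ => Finset.sum_filter _ _
      rw [Finset.sum_congr rfl hr, Finset.sum_comm]
      apply Finset.sum_le_sum
      intro M hM
      obtain ⟨A, hA, hv⟩ := pm_cover hM hv0
      have hAG : A ∈ G.filter (fun A => v0 ∈ A) := mem_filter.2 ⟨(mem_pmSet.1 hM).1 hA, hv⟩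
      refine le_trans ?_ (Finset.single_le_sum (f := fun A => if A ∈ M then
        (∏ B ∈ M, w B) / (∏ v ∈ Fs W κ M, Nv G w κ M v) else 0) ?_ hAG)
      · simp [hA]
      · intro A _
        split_ifs
        · exact hnn M
        · exact le_rfl
    refine step1.trans ?_
    have step2 : ∀ A ∈ G.filter (fun A => v0 ∈ A),
        ∑ M ∈ (pmSet W G).filter (fun M => A ∈ M),
          (∏ B ∈ M, w B) / (∏ v ∈ Fs W κ M, Nv G w κ M v) ≤ w A / T := by
      intro A hA
      obtain ⟨hAG, hvA⟩ := mem_filter.1 hA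
      obtain ⟨hAW, hAne⟩ := hG A hAG
      rw [pm_sum_through W G A hAG hAW hAne]
      have hih := ih (W \ A) (minus G A) (by
          have : (W \ A).card < W.card := by
            apply card_lt_card
            refine ⟨sdiff_subset, fun h => ?_⟩
            have := h hv0
            simp [hvA] at this
          omega) (by
          intro B hB
          obtain ⟨hB1, hB2⟩ := mem_filter.1 hB
          refine ⟨fun x hx => ?_, (hG B hB1).2⟩
          refine mem_sdiff.2 ⟨(hG B hB1).1 hx, fun hxA => ?_⟩
          have : x ∈ B ∩ A := mem_inter.2 ⟨hx, hxA⟩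
          rw [hB2] at this
          simp at this) (hκ.mono (by
            intro x hx
            have := mem_coe.1 hx
            exact mem_coe.2 (mem_sdiff.1 this).1))
      have key : ∀ M ∈ pmSet (W \ A) (minus G A),
          (∏ B ∈ insert A M, w B) / (∏ v ∈ Fs W κ (insert A M), Nv G w κ (insert A M) v)
          = (w A / T) * ((∏ B ∈ M, w B) / (∏ v ∈ Fs (W \ A) κ M, Nv (minus G A) w κ M v)) := by
        intro M hM
        have hAM : A ∉ M := by
          intro hAM
          have h1 := (mem_pmSet.1 hM).1 hAM
          simp only [minus, mem_filter, inter_self] at h1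
          exact hAne.ne_empty h1.2
        have hF : Fs W κ (insert A M) = insert v0 (Fs (W \ A) κ M) := by
          ext v
          simp only [Fs, mem_filter, mem_insert, mem_sdiff]
          constructor
          · rintro ⟨hvW, B, rfl | hB, hvB, hle⟩
            · left
              exact hκ hvW hv0 (le_antisymm (hle v0 hvA) (hmin v hvW))
            · right
              have := pm_subset hM hB hvB
              exact ⟨mem_sdiff.1 this, B, hB, hvB, hle⟩
          · rintro (rfl | ⟨⟨h1, h2⟩, B, hB, hvB, hle⟩)
            · exact ⟨hv0, A, Or.inl rfl, hvA, fun u hu => hmin u (hAW hu)⟩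
            · exact ⟨h1, B, Or.inr hB, hvB, hle⟩
        have hv0F : v0 ∉ Fs (W \ A) κ M := by
          simp [Fs, hvA]
        have hN0 : Nv G w κ (insert A M) v0 = T := by
          rw [hT, Nv]
          congr 1
          apply Finset.filter_congr
          intro B hB
          constructor
          · exact fun h => h.1
          · intro h
            refine ⟨h, ?_⟩
            rintro C hC ⟨u, hu, hlt⟩
            have huW : u ∈ W := by
              rcases mem_insert.1 hC with rfl | hC
              · exact hAW hu
              · exact (mem_sdiff.1 (pm_subset hM hC hu)).1
            exact absurd (hmin u huW) (not_le.2 hlt)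
        have hN : ∀ v ∈ Fs (W \ A) κ M, Nv G w κ (insert A M) v = Nv (minus G A) w κ M v := by
          intro v hv
          have hvW : v ∈ W \ A := (mem_filter.1 hv).1
          obtain ⟨hvW, hvA'⟩ := mem_sdiff.1 hvW
          have hlt : κ v0 < κ v := by
            refine lt_of_le_of_ne (hmin v hvW) fun h => ?_
            have := hκ hv0 hvW h
            subst this
            exact hvA' hvA
          rw [Nv, Nv, minus, Finset.filter_filter]
          congr 1
          apply Finset.filter_congr
          intro B hB
          constructor
          · rintro ⟨h1, h2⟩
            exact ⟨h2 A (mem_insert_self _ _) ⟨v0, hvA, hlt⟩, h1,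
              fun C hC => h2 C (mem_insert_of_mem hC)⟩
          · rintro ⟨h1, h2, h3⟩
            refine ⟨h2, fun C hC h => ?_⟩
            rcases mem_insert.1 hC with rfl | hC
            · exact h1
            · exact h3 C hC h
        rw [hF, prod_insert hAM, prod_insert hv0F, hN0, prod_congr rfl hN, div_mul_div_comm]
      rw [Finset.sum_congr rfl key, ← Finset.mul_sum]
      have hwT : 0 ≤ w A / T := div_nonneg (hw A).le (sum_nonneg fun A _ => (hw A).le)
      calc _ ≤ w A / T * 1 := mul_le_mul_of_nonneg_left hih hwT
        _ = _ := mul_one _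
    refine (Finset.sum_le_sum step2).trans ?_
    rw [← Finset.sum_div, ← hT]
    exact div_self_le_one T

/-- The entropy-type bound for a fixed order. -/
lemma order_bound (w : Finset ℕ → ℝ) (hw : ∀ A, 0 < w A) (κ : ℕ → ℕ)
    (W : Finset ℕ) (G : Finset (Finset ℕ))
    (hG : ∀ A ∈ G, A ⊆ W ∧ A.Nonempty) (hκ : Set.InjOn κ W) :
    (pmCount W G : ℝ) * Real.log (pmCount W G) ≤
    ∑ M ∈ pmSet W G, ((∑ v ∈ Fs W κ M, Real.log (Nv G w κ M v)) - ∑ B ∈ M, Real.log (w B)) := by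
  have hg := greedy w hw κ W.card W G le_rfl hG hκ
  rcases Nat.eq_zero_or_pos (pmCount W G) with h0 | hpos
  · have : pmSet W G = ∅ := by simpa [pmCount] using h0
    simp [h0, this]
  have hΦ : (0:ℝ) < pmCount W G := by exact_mod_cast hpos
  have hNpos : ∀ M ∈ pmSet W G, ∀ v ∈ Fs W κ M, 0 < Nv G w κ M v := by
    intro M hM v hv
    obtain ⟨hvW, B, hB, hvB, hle⟩ := mem_filter.1 hv
    refine lt_of_lt_of_le (hw B) ?_
    refine Finset.single_le_sum (f := w) (fun A _ => (hw A).le) ?_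
    refine mem_filter.2 ⟨(mem_pmSet.1 hM).1 hB, hvB, ?_⟩
    rintro C hC ⟨u, hu, hlt⟩
    apply (mem_pmSet.1 hM).2.1 B hB C hC
    rintro rfl
    exact absurd (hle u hu) (not_le.2 hlt)
  have h1 : ∀ M ∈ pmSet W G, Real.log (pmCount W G) -
      ((∑ v ∈ Fs W κ M, Real.log (Nv G w κ M v)) - ∑ B ∈ M, Real.log (w B))
      ≤ pmCount W G * ((∏ B ∈ M, w B) / (∏ v ∈ Fs W κ M, Nv G w κ M v)) - 1 := by
    intro M hM
    have p1 : 0 < ∏ B ∈ M, w B := prod_pos fun A _ => hw A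
    have p2 : 0 < ∏ v ∈ Fs W κ M, Nv G w κ M v := prod_pos (hNpos M hM)
    have := Real.log_le_sub_one_of_pos (mul_pos hΦ (div_pos p1 p2))
    rw [Real.log_mul hΦ.ne' (div_pos p1 p2).ne', Real.log_div p1.ne' p2.ne',
      Real.log_prod (fun A _ => (hw A).ne'), Real.log_prod (fun v hv => (hNpos M hM v hv).ne')] at this
    linarith
  have h2 := Finset.sum_le_sum h1
  simp only [Finset.sum_sub_distrib, Finset.sum_const, ← Finset.mul_sum, nsmul_eq_mul] at h2
  have hc : ((pmSet W G).card : ℝ) = pmCount W G := rfl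
  rw [hc] at h2
  rw [Finset.sum_sub_distrib]
  nlinarith

/-- Extension of `f` to all naturals. -/
def gx {n N : ℕ} (f : Fin n → Fin N) (x : ℕ) : ℕ := if h : x < n then (f ⟨x, h⟩ : ℕ) else 0

/-- Injective key built from `f`. -/
def kap {n N : ℕ} (f : Fin n → Fin N) (x : ℕ) : ℕ := gx f x * n + x

lemma kap_inj {n N : ℕ} (f : Fin n → Fin N) : Set.InjOn (kap f) (Finset.range n) := by
  intro x hx y hy h
  have hx' : x < n := by simpa using hx
  have hy' : y < n := by simpa using hy
  have h1 : (gx f x * n + x) % n = (gx f y * n + y) % n := by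
    have : gx f x * n + x = gx f y * n + y := h
    rw [this]
  simpa [Nat.mod_eq_of_lt hx', Nat.mod_eq_of_lt hy'] using h1

lemma gx_le_of_kap {n N : ℕ} (f : Fin n → Fin N) {x y : ℕ} (hy : y < n)
    (h : kap f x ≤ kap f y) : gx f x ≤ gx f y := by
  by_contra hc
  push Not at hc
  have : (gx f y + 1) * n ≤ gx f x * n := Nat.mul_le_mul_right n hc
  unfold kap at h
  nlinarith

lemma count_card {n N : ℕ} (S : Finset ℕ) (hS : S ⊆ Finset.range n) (v : ℕ) (hv : v ∈ S)
    (k : ℕ) (hk : k < N) :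
    ((Finset.univ : Finset (Fin n → Fin N)).filter
      (fun f => gx f v = k ∧ ∀ x ∈ S, k ≤ gx f x)).card = N ^ (n - S.card) * (N - k) ^ (S.card - 1) := by
  have hvn : v < n := by simpa using hS hv
  have e : (Finset.univ : Finset (Fin n → Fin N)).filter
      (fun f => gx f v = k ∧ ∀ x ∈ S, k ≤ gx f x) =
      Fintype.piFinset (fun i : Fin n => if (i : ℕ) ∈ S then
        (if (i : ℕ) = v then {(⟨k, hk⟩ : Fin N)} else Finset.Ici (⟨k, hk⟩ : Fin N)) else Finset.univ) := by
    ext f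
    simp only [mem_filter, mem_univ, true_and, Fintype.mem_piFinset]
    constructor
    · rintro ⟨h1, h2⟩ i
      split_ifs with hi hiv
      · subst hiv
        simp only [gx, i.2, dif_pos] at h1
        rw [mem_singleton]
        exact Fin.ext h1
      · have := h2 i hi
        simp only [gx, i.2, dif_pos] at this
        rw [mem_Ici]
        exact this
      · exact mem_univ _
    · intro h
      have hvv : gx f v = k := by
        have := h ⟨v, hvn⟩
        simp only [hv, if_true, mem_singleton] at this
        simp [gx, hvn, this]
      refine ⟨hvv, fun x hx => ?_⟩
      have hxn : x < n := by simpa using hS hx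
      by_cases hxv : x = v
      · rw [hxv, hvv]
      · have := h ⟨x, hxn⟩
        simp only [hx, if_true, hxv, if_false, mem_Ici] at this
        simp only [gx, hxn, dif_pos]
        exact this
  rw [e, Fintype.card_piFinset]
  have e2 : ∀ i : Fin n, (if (i : ℕ) ∈ S then
        (if (i : ℕ) = v then {(⟨k, hk⟩ : Fin N)} else Finset.Ici (⟨k, hk⟩ : Fin N)) else Finset.univ).card
      = (fun x : ℕ => if x ∈ S then (if x = v then 1 else N - k) else N) i := by
    intro i
    dsimp only
    split_ifs <;> simp
  rw [Finset.prod_congr rfl (fun i _ => e2 i),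
    ← Finset.prod_range (fun x : ℕ => if x ∈ S then (if x = v then 1 else N - k) else N),
    Finset.prod_ite]
  have e3 : (Finset.range n).filter (fun x => x ∈ S) = S := by
    ext x; simp only [mem_filter]
    exact ⟨fun h => h.2, fun h => ⟨hS h, h⟩⟩
  have e4 : (Finset.range n).filter (fun x => ¬ x ∈ S) = Finset.range n \ S := by
    ext x; simp
  rw [e3, e4, prod_const, card_sdiff_of_subset hS, card_range, mul_comm,
    ← Finset.mul_prod_erase S _ hv]
  simp only [if_true, one_mul]
  congr 1
  rw [← card_erase_of_mem hv, ← prod_const]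
  apply prod_congr rfl
  intro x hx
  rw [if_neg (mem_erase.1 hx).1]

lemma count_sum {n N : ℕ} (hN : 0 < N) (S : Finset ℕ) (hS : S ⊆ Finset.range n) (v : ℕ) (hv : v ∈ S)
    (φ : ℕ → ℝ) :
    ∑ f : Fin n → Fin N, (if ∀ x ∈ S, gx f v ≤ gx f x then φ (gx f v) else 0)
      = (N : ℝ) ^ n * ((1 / N) * ∑ k ∈ Finset.range N, φ k * (((N : ℝ) - k) / N) ^ (S.card - 1)) := by
  have hvn : v < n := by simpa using hS hv
  have hlt : ∀ f : Fin n → Fin N, gx f v < N := by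
    intro f; simp [gx, hvn]
  have h1 : ∀ f : Fin n → Fin N, (if ∀ x ∈ S, gx f v ≤ gx f x then φ (gx f v) else 0)
      = ∑ k ∈ Finset.range N, if (gx f v = k ∧ ∀ x ∈ S, k ≤ gx f x) then φ k else 0 := by
    intro f
    rw [Finset.sum_eq_single (gx f v)]
    · simp
    · intro k _ hk
      rw [if_neg]
      exact fun h => hk h.1.symm
    · intro h
      exact absurd (mem_range.2 (hlt f)) h
  rw [Finset.sum_congr rfl (fun f _ => h1 f), Finset.sum_comm, mul_sum, mul_sum]
  apply sum_congr rfl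
  intro k hk
  have hk := mem_range.1 hk
  rw [← Finset.sum_filter, sum_const, count_card S hS v hv k hk, nsmul_eq_mul]
  push_cast [Nat.cast_sub hk.le]
  have hSn : S.card ≤ n := by simpa using card_le_card hS
  have hS1 : 1 ≤ S.card := card_pos.2 ⟨v, hv⟩
  have hN' : (N : ℝ) ≠ 0 := by positivity
  obtain ⟨j, hj⟩ : ∃ j, S.card = j + 1 := ⟨S.card - 1, by omega⟩
  obtain ⟨l, hl⟩ : ∃ l, n = S.card + l := ⟨n - S.card, by omega⟩
  have : n - S.card = l := by omega
  rw [this, hj, Nat.add_sub_cancel, hl, hj, div_pow]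
  field_simp
  ring

/-- Vertices covered by the matching edges that meet `A`. -/
def Um (M : Finset (Finset ℕ)) (A : Finset ℕ) : Finset ℕ :=
  (M.filter (fun B => (B ∩ A).Nonempty)).biUnion id

/-- Edges meeting some matching edge at least twice. -/
def Bad (H M : Finset (Finset ℕ)) : Finset (Finset ℕ) :=
  H.filter (fun A => ∃ B ∈ M, 2 ≤ (A ∩ B).card)

lemma Um_card {W : Finset ℕ} {H M : Finset (Finset ℕ)} {r : ℕ} (hM : M ∈ pmSet W H)
    (hr : ∀ A ∈ H, A.card = r) (A : Finset ℕ) :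
    (Um M A).card = (M.filter (fun B => (B ∩ A).Nonempty)).card * r := by
  rw [Um, card_biUnion]
  · rw [sum_const_nat]
    intro B hB
    exact hr B ((mem_pmSet.1 hM).1 (mem_filter.1 hB).1)
  · intro B hB C hC hBC
    exact disjoint_iff_inter_eq_empty.2 ((mem_pmSet.1 hM).2.1 B (mem_filter.1 hB).1 C (mem_filter.1 hC).1 hBC)

lemma sub_Um {W : Finset ℕ} {H M : Finset (Finset ℕ)} (hM : M ∈ pmSet W H)
    {A : Finset ℕ} (hA : A ⊆ W) : A ⊆ Um M A := by
  intro x hx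
  obtain ⟨B, hB, hxB⟩ := pm_cover hM (hA hx)
  exact mem_biUnion.2 ⟨B, mem_filter.2 ⟨hB, ⟨x, mem_inter.2 ⟨hxB, hx⟩⟩⟩, hxB⟩

lemma Um_sub {W : Finset ℕ} {H M : Finset (Finset ℕ)} (hM : M ∈ pmSet W H)
    (A : Finset ℕ) : Um M A ⊆ W := by
  intro x hx
  obtain ⟨B, hB, hxB⟩ := mem_biUnion.1 hx
  exact pm_subset hM (mem_filter.1 hB).1 hxB

lemma Um_card_single {W : Finset ℕ} {H M : Finset (Finset ℕ)} {r : ℕ} (hM : M ∈ pmSet W H)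
    (hr : ∀ A ∈ H, A.card = r) {v : ℕ} (hv : v ∈ W) :
    (Um M {v}).card = r := by
  rw [Um_card hM hr]
  obtain ⟨B, hB, hxB⟩ := pm_cover hM hv
  have : M.filter (fun B => (B ∩ {v}).Nonempty) = {B} := by
    ext C
    simp only [mem_filter, mem_singleton]
    constructor
    · rintro ⟨hC, x, hx⟩
      simp only [mem_inter, mem_singleton] at hx
      rw [hx.2] at hx
      exact pm_eq_of_mem hM hC hB hx.1 hxB
    · rintro rfl
      exact ⟨hB, v, by simp [hxB]⟩
  rw [this]; simp

lemma Um_card_good {W : Finset ℕ} {H M : Finset (Finset ℕ)} {r : ℕ} (hM : M ∈ pmSet W H)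
    (hr : ∀ A ∈ H, A.card = r) (hW : ∀ A ∈ H, A ⊆ W) {A : Finset ℕ} (hA : A ∈ H) (hb : A ∉ Bad H M) :
    (Um M A).card = r * r := by
  rw [Um_card hM hr]
  congr 1
  have h1 : A.card = ∑ B ∈ M.filter (fun B => (B ∩ A).Nonempty), (B ∩ A).card := by
    rw [← card_biUnion]
    · congr 1
      ext x
      simp only [mem_biUnion, mem_filter, mem_inter]
      constructor
      · intro hx
        obtain ⟨B, hB, hxB⟩ := pm_cover hM (hW A hA hx)
        exact ⟨B, ⟨hB, x, mem_inter.2 ⟨hxB, hx⟩⟩, hxB, hx⟩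
      · rintro ⟨B, _, _, hx⟩
        exact hx
    · intro B hB C hC hBC
      have := disjoint_iff_inter_eq_empty.2
        ((mem_pmSet.1 hM).2.1 B (mem_filter.1 hB).1 C (mem_filter.1 hC).1 hBC)
      exact this.mono inter_subset_left inter_subset_left
  rw [← hr A hA, h1, card_eq_sum_ones]
  apply sum_congr rfl
  intro B hB
  obtain ⟨hB, hne⟩ := mem_filter.1 hB
  have h2 : 0 < (B ∩ A).card := card_pos.2 hne
  have h3 : ¬ 2 ≤ (A ∩ B).card := fun h => hb (mem_filter.2 ⟨hA, B, hB, h⟩)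
  rw [inter_comm] at h3
  omega

lemma Bad_card {W : Finset ℕ} {H M : Finset (Finset ℕ)} {r : ℕ} (hM : M ∈ pmSet W H)
    (hr : ∀ A ∈ H, A.card = r) {d : ℝ} (hd0 : 0 ≤ d)
    (hd : ∀ x ∈ W, ∀ y ∈ W, x ≠ y → (codeg H x y : ℝ) ≤ d) :
    ((Bad H M).card : ℝ) ≤ r * W.card * d := by
  have h1 : Bad H M ⊆ M.biUnion fun B => B.offDiag.biUnion fun p =>
      H.filter (fun A => p.1 ∈ A ∧ p.2 ∈ A) := by
    intro A hA
    obtain ⟨hA, B, hB, h2⟩ := mem_filter.1 hA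
    obtain ⟨x, hx, y, hy, hxy⟩ := Finset.one_lt_card.1 (show 1 < (A ∩ B).card by omega)
    rw [mem_inter] at hx hy
    refine mem_biUnion.2 ⟨B, hB, mem_biUnion.2 ⟨(x, y), ?_, ?_⟩⟩
    · exact mem_offDiag.2 ⟨hx.2, hy.2, hxy⟩
    · exact mem_filter.2 ⟨hA, hx.1, hy.1⟩
  have h2 : ((Bad H M).card : ℝ) ≤ ∑ B ∈ M, ∑ p ∈ B.offDiag, (codeg H p.1 p.2 : ℝ) := by
    have := (card_le_card h1).trans (card_biUnion_le.trans (sum_le_sum fun B _ => card_biUnion_le))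
    exact_mod_cast this
  have hWc : W.card = M.card * r := by
    conv_lhs => rw [← (mem_pmSet.1 hM).2.2]
    rw [card_biUnion]
    · exact sum_const_nat fun B hB => hr B ((mem_pmSet.1 hM).1 hB)
    · intro B hB C hC hBC
      exact disjoint_iff_inter_eq_empty.2 ((mem_pmSet.1 hM).2.1 B hB C hC hBC)
  calc _ ≤ _ := h2
    _ ≤ ∑ B ∈ M, ((r : ℝ) * r) * d := by
      apply sum_le_sum
      intro B hB
      have hBr : B.card = r := hr B ((mem_pmSet.1 hM).1 hB)
      calc _ ≤ ∑ p ∈ B.offDiag, d := by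
            apply sum_le_sum
            intro p hp
            obtain ⟨p1, p2, p3⟩ := mem_offDiag.1 hp
            exact hd _ (pm_subset hM hB p1) _ (pm_subset hM hB p2) p3
        _ = (B.offDiag.card : ℝ) * d := by rw [sum_const, nsmul_eq_mul]
        _ ≤ ((r : ℝ) * r) * d := by
          apply mul_le_mul_of_nonneg_right _ hd0
          rw [offDiag_card, hBr]
          have : r * r - r ≤ r * r := Nat.sub_le _ _
          exact_mod_cast this
    _ = r * W.card * d := by
      rw [sum_const, nsmul_eq_mul, hWc]; push_cast; ring

lemma log_tangent {x c : ℝ} (hx : 0 < x) (hc : 0 < c) : Real.log x ≤ Real.log c - 1 + x / c := by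
  have := Real.log_le_sub_one_of_pos (div_pos hx hc)
  rw [Real.log_div hx.ne' hc.ne'] at this
  linarith

lemma pointwise {n N : ℕ} {H M : Finset (Finset ℕ)} (hM : M ∈ pmSet (Finset.range n) H)
    (w : Finset ℕ → ℝ) (hw1 : ∀ A, 1 ≤ w A) (c : ℕ → ℝ) (hc : ∀ k, 0 < c k)
    (f : Fin n → Fin N) (v : ℕ) (hv : v ∈ Finset.range n) :
    (if v ∈ Fs (Finset.range n) (kap f) M then Real.log (Nv H w (kap f) M v) else 0)
    ≤ (if ∀ x ∈ Um M {v}, gx f v ≤ gx f x then Real.log (c (gx f v)) - 1 else 0)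
      + ∑ A ∈ H.filter (fun A => v ∈ A), w A *
        (if ∀ x ∈ Um M A, gx f v ≤ gx f x then 1 / c (gx f v) else 0) := by
  have hw : ∀ A, 0 < w A := fun A => lt_of_lt_of_le one_pos (hw1 A)
  set X : ℝ := ∑ A ∈ H.filter (fun A => v ∈ A), w A *
        (if ∀ x ∈ Um M A, gx f v ≤ gx f x then 1 else 0) with hX
  have hXc : ∑ A ∈ H.filter (fun A => v ∈ A), w A *
        (if ∀ x ∈ Um M A, gx f v ≤ gx f x then 1 / c (gx f v) else 0) = X / c (gx f v) := by
    rw [hX, sum_div]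
    apply sum_congr rfl
    intro A _
    split_ifs
    · ring
    · simp
  rw [hXc]
  have hX0 : 0 ≤ X := by
    apply sum_nonneg
    intro A _
    apply mul_nonneg (hw A).le
    split_ifs <;> norm_num
  by_cases hE : ∀ x ∈ Um M {v}, gx f v ≤ gx f x
  · rw [if_pos hE]
    obtain ⟨B, hB, hvB⟩ := pm_cover hM hv
    have hBH : B ∈ H := (mem_pmSet.1 hM).1 hB
    have hBU : Um M B ⊆ Um M {v} := by
      intro x hx
      obtain ⟨C, hC, hxC⟩ := mem_biUnion.1 hx
      obtain ⟨hCM, y, hy⟩ := mem_filter.1 hC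
      rw [mem_inter] at hy
      have := pm_eq_of_mem hM hCM hB hy.1 hy.2
      subst this
      exact mem_biUnion.2 ⟨C, mem_filter.2 ⟨hCM, v, by simp [hvB]⟩, hxC⟩
    have hX1 : 1 ≤ X := by
      refine (hw1 B).trans ?_
      have := Finset.single_le_sum (f := fun A => w A *
        (if ∀ x ∈ Um M A, gx f v ≤ gx f x then (1:ℝ) else 0)) (s := H.filter (fun A => v ∈ A))
        (fun A _ => by
          apply mul_nonneg (hw A).le
          split_ifs <;> norm_num) (mem_filter.2 ⟨hBH, hvB⟩)
      rw [if_pos (fun x hx => hE x (hBU hx)), mul_one] at this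
      exact this
    have hlog : Real.log X ≤ Real.log (c (gx f v)) - 1 + X / c (gx f v) :=
      log_tangent (by linarith) (hc _)
    by_cases hF : v ∈ Fs (Finset.range n) (kap f) M
    · rw [if_pos hF]
      refine le_trans ?_ hlog
      have hNX : Nv H w (kap f) M v ≤ X := by
        rw [Nv, hX]
        simp_rw [mul_ite, mul_one, mul_zero]
        rw [← sum_filter, filter_filter]
        apply sum_le_sum_of_subset_of_nonneg
        · intro A hA
          obtain ⟨hA, hvA, hd⟩ := mem_filter.1 hA
          refine mem_filter.2 ⟨hA, hvA, ?_⟩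
          intro x hx
          obtain ⟨C, hC, hxC⟩ := mem_biUnion.1 hx
          obtain ⟨hC, y, hy⟩ := mem_filter.1 hC
          by_contra hlt
          have hxn : x < n := by simpa using pm_subset hM hC hxC
          have hk : kap f x < kap f v := by
            by_contra hge
            exact hlt (gx_le_of_kap f hxn (not_lt.1 hge))
          have := hd C hC ⟨x, hxC, hk⟩
          rw [inter_comm] at this
          rw [this] at hy
          simp at hy
        · intro A _ _
          exact (hw A).le
      rcases eq_or_lt_of_le (Nv_nonneg H w hw (kap f) M v) with h0 | hpos
      · rw [← h0, Real.log_zero]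
        exact Real.log_nonneg hX1
      · exact Real.log_le_log hpos hNX
    · rw [if_neg hF]
      exact le_trans (Real.log_nonneg hX1) hlog
  · have hF : v ∉ Fs (Finset.range n) (kap f) M := by
      intro hF
      obtain ⟨_, B, hB, hvB, hle⟩ := mem_filter.1 hF
      apply hE
      intro x hx
      obtain ⟨C, hC, hxC⟩ := mem_biUnion.1 hx
      obtain ⟨hC, y, hy⟩ := mem_filter.1 hC
      simp only [mem_inter, mem_singleton] at hy
      rw [hy.2] at hy
      have := pm_eq_of_mem hM hC hB hy.1 hvB
      subst this
      have hxn : x < n := by simpa using pm_subset hM hC hxC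
      exact gx_le_of_kap f hxn (hle x hxC)
    rw [if_neg hF, if_neg hE, zero_add]
    exact div_nonneg hX0 (hc _).le

lemma avg_bound {n N r : ℕ} (hN : 0 < N) (hr1 : 1 ≤ r) {H M : Finset (Finset ℕ)}
    (hM : M ∈ pmSet (Finset.range n) H)
    (hW : ∀ A ∈ H, A ⊆ Finset.range n) (hr : ∀ A ∈ H, A.card = r)
    (w : Finset ℕ → ℝ) (hw1 : ∀ A, 1 ≤ w A) (hw2 : ∀ A, w A ≤ 2)
    (c : ℕ → ℝ) (hc : ∀ k, 0 < c k) :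
    ∑ f : Fin n → Fin N, ∑ v ∈ Fs (Finset.range n) (kap f) M, Real.log (Nv H w (kap f) M v)
    ≤ (N : ℝ) ^ n * ((1 / N) * ∑ k ∈ Finset.range N,
      (n * (Real.log (c k) - 1) * (((N : ℝ) - k) / N) ^ (r - 1)
       + 1 / c k * (r * ((((N : ℝ) - k) / N) ^ (r * r - 1) * (∑ A ∈ H, w A)
          + (((N : ℝ) - k) / N) ^ (r - 1) * (2 * (Bad H M).card))))) := by
  have hw : ∀ A, 0 < w A := fun A => lt_of_lt_of_le one_pos (hw1 A)
  have h1 : ∀ f : Fin n → Fin N,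
      ∑ v ∈ Fs (Finset.range n) (kap f) M, Real.log (Nv H w (kap f) M v) ≤
      ∑ v ∈ Finset.range n, ((if ∀ x ∈ Um M {v}, gx f v ≤ gx f x then Real.log (c (gx f v)) - 1 else 0)
      + ∑ A ∈ H.filter (fun A => v ∈ A), w A *
        (if ∀ x ∈ Um M A, gx f v ≤ gx f x then 1 / c (gx f v) else 0)) := by
    intro f
    have : ∑ v ∈ Fs (Finset.range n) (kap f) M, Real.log (Nv H w (kap f) M v) =
        ∑ v ∈ Finset.range n,
        if v ∈ Fs (Finset.range n) (kap f) M then Real.log (Nv H w (kap f) M v) else 0 := by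
      rw [← sum_filter]
      congr 1
      ext v
      simp only [mem_filter, Fs]
      tauto
    rw [this]
    exact sum_le_sum fun v hv => pointwise hM w hw1 c hc f v hv
  refine (sum_le_sum fun f _ => h1 f).trans ?_
  rw [sum_comm]
  have h2 : ∀ v ∈ Finset.range n, ∑ f : Fin n → Fin N,
      ((if ∀ x ∈ Um M {v}, gx f v ≤ gx f x then Real.log (c (gx f v)) - 1 else 0)
      + ∑ A ∈ H.filter (fun A => v ∈ A), w A *
        (if ∀ x ∈ Um M A, gx f v ≤ gx f x then 1 / c (gx f v) else 0))
      = (N : ℝ) ^ n * ((1 / N) * ∑ k ∈ Finset.range N,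
          (Real.log (c k) - 1) * (((N : ℝ) - k) / N) ^ (r - 1))
        + ∑ A ∈ H.filter (fun A => v ∈ A), w A * ((N : ℝ) ^ n * ((1 / N) * ∑ k ∈ Finset.range N,
          (1 / c k) * (((N : ℝ) - k) / N) ^ ((Um M A).card - 1))) := by
    intro v hv
    rw [sum_add_distrib]
    congr 1
    · have hs : ({v} : Finset ℕ) ⊆ Finset.range n := by simpa using hv
      rw [count_sum hN (Um M {v}) (Um_sub hM _) v (sub_Um hM hs (mem_singleton_self v))
        (fun k => Real.log (c k) - 1), Um_card_single hM hr hv]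
    · rw [sum_comm]
      apply sum_congr rfl
      intro A hA
      obtain ⟨hA, hvA⟩ := mem_filter.1 hA
      rw [← mul_sum, count_sum hN (Um M A) (Um_sub hM _) v (sub_Um hM (hW A hA) hvA)
        (fun k => 1 / c k)]
  rw [sum_congr rfl h2, sum_add_distrib, sum_const, card_range, nsmul_eq_mul]
  have h3 : ∑ v ∈ Finset.range n, ∑ A ∈ H.filter (fun A => v ∈ A), w A * ((N : ℝ) ^ n * ((1 / N) *
        ∑ k ∈ Finset.range N, (1 / c k) * (((N : ℝ) - k) / N) ^ ((Um M A).card - 1)))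
      = ∑ A ∈ H, r * (w A * ((N : ℝ) ^ n * ((1 / N) *
        ∑ k ∈ Finset.range N, (1 / c k) * (((N : ℝ) - k) / N) ^ ((Um M A).card - 1)))) := by
    simp_rw [sum_filter]
    rw [sum_comm]
    apply sum_congr rfl
    intro A hA
    rw [← sum_filter, sum_const, nsmul_eq_mul]
    have : (Finset.range n).filter (fun v => v ∈ A) = A := by
      ext x; simp only [mem_filter]
      exact ⟨fun h => h.2, fun h => ⟨hW A hA h, h⟩⟩
    rw [this, hr A hA]
  rw [h3]
  have hs0 : ∀ k ∈ Finset.range N, 0 ≤ ((N : ℝ) - k) / N ∧ ((N : ℝ) - k) / N ≤ 1 := by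
    intro k hk
    have hk : (k : ℝ) < N := by exact_mod_cast mem_range.1 hk
    have hN' : (0:ℝ) < N := by exact_mod_cast hN
    constructor
    · apply div_nonneg <;> linarith
    · rw [div_le_one hN']
      have : (0:ℝ) ≤ k := Nat.cast_nonneg k
      linarith
  have h4 : ∀ A ∈ H, ∀ k ∈ Finset.range N, w A * (((N : ℝ) - k) / N) ^ ((Um M A).card - 1) ≤
      w A * (((N : ℝ) - k) / N) ^ (r * r - 1) +
      (if A ∈ Bad H M then 2 * (((N : ℝ) - k) / N) ^ (r - 1) else 0) := by
    intro A hA k hk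
    obtain ⟨s0, s1⟩ := hs0 k hk
    by_cases hb : A ∈ Bad H M
    · rw [if_pos hb]
      have e1 : r ≤ (Um M A).card := by
        rw [← hr A hA]
        exact card_le_card (sub_Um hM (hW A hA))
      have e2 : (((N : ℝ) - k) / N) ^ ((Um M A).card - 1) ≤ (((N : ℝ) - k) / N) ^ (r - 1) :=
        pow_le_pow_of_le_one s0 s1 (by omega)
      have e3 : w A * (((N : ℝ) - k) / N) ^ ((Um M A).card - 1) ≤ 2 * (((N : ℝ) - k) / N) ^ (r - 1) :=
        mul_le_mul (hw2 A) e2 (pow_nonneg s0 _) (by norm_num)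
      have e4 : 0 ≤ w A * (((N : ℝ) - k) / N) ^ (r * r - 1) := mul_nonneg (hw A).le (pow_nonneg s0 _)
      linarith
    · rw [if_neg hb, Um_card_good hM hr hW hA hb, add_zero]
  have h5 : ∑ A ∈ H, r * (w A * ((N : ℝ) ^ n * ((1 / N) *
        ∑ k ∈ Finset.range N, (1 / c k) * (((N : ℝ) - k) / N) ^ ((Um M A).card - 1))))
      = (N : ℝ) ^ n * ((1 / N) * ∑ k ∈ Finset.range N, (1 / c k) * (r *
        ∑ A ∈ H, w A * (((N : ℝ) - k) / N) ^ ((Um M A).card - 1))) := by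
    simp_rw [mul_sum]
    rw [sum_comm]
    apply sum_congr rfl
    intro k _
    apply sum_congr rfl
    intro A _
    ring
  have h6 : (n:ℝ) * ((N : ℝ) ^ n * ((1 / N) * ∑ k ∈ Finset.range N,
          (Real.log (c k) - 1) * (((N : ℝ) - k) / N) ^ (r - 1)))
      = (N : ℝ) ^ n * ((1 / N) * ∑ k ∈ Finset.range N,
          n * (Real.log (c k) - 1) * (((N : ℝ) - k) / N) ^ (r - 1)) := by
    simp_rw [mul_sum]
    apply sum_congr rfl
    intro k _
    ring
  rw [h5, h6, ← mul_add, ← mul_add, ← sum_add_distrib]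
  apply mul_le_mul_of_nonneg_left _ (by positivity)
  apply mul_le_mul_of_nonneg_left _ (by positivity)
  apply sum_le_sum
  intro k hk
  have hck := hc k
  have h7 : ∑ A ∈ H, w A * (((N : ℝ) - k) / N) ^ ((Um M A).card - 1) ≤
      (((N : ℝ) - k) / N) ^ (r * r - 1) * (∑ A ∈ H, w A)
          + (((N : ℝ) - k) / N) ^ (r - 1) * (2 * (Bad H M).card) := by
    refine (sum_le_sum fun A hA => h4 A hA k hk).trans (le_of_eq ?_)
    rw [sum_add_distrib, ← sum_filter, sum_const, nsmul_eq_mul, ← sum_mul]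
    have : H.filter (fun A => A ∈ Bad H M) = Bad H M := by
      ext A; simp only [mem_filter, Bad]; tauto
    rw [this]; ring
  gcongr

lemma pow_diff_le (q : ℕ) {x y : ℝ} (hx : 0 ≤ x) (hxy : x ≤ y) :
    y ^ (q + 1) - x ^ (q + 1) ≤ (q + 1) * y ^ q * (y - x) := by
  induction q with
  | zero => simp
  | succ q ih =>
    have hy : 0 ≤ y := hx.trans hxy
    have h1 := mul_le_mul_of_nonneg_left ih hy
    have h2 : x ^ (q + 1) * (y - x) ≤ y ^ (q + 1) * (y - x) :=
      mul_le_mul_of_nonneg_right (pow_le_pow_left₀ hx hxy _) (by linarith)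
    push_cast
    calc y ^ (q + 1 + 1) - x ^ (q + 1 + 1)
        = y * (y ^ (q + 1) - x ^ (q + 1)) + x ^ (q + 1) * (y - x) := by ring
      _ ≤ y * ((q + 1) * y ^ q * (y - x)) + y ^ (q + 1) * (y - x) := add_le_add h1 h2
      _ = _ := by ring

lemma le_pow_diff (q : ℕ) {x y : ℝ} (hx : 0 ≤ x) (hxy : x ≤ y) :
    (q + 1) * x ^ q * (y - x) ≤ y ^ (q + 1) - x ^ (q + 1) := by
  induction q with
  | zero => simp
  | succ q ih =>
    have h1 := mul_le_mul_of_nonneg_left ih hx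
    have h2 : x ^ (q + 1) * (y - x) ≤ y ^ (q + 1) * (y - x) :=
      mul_le_mul_of_nonneg_right (pow_le_pow_left₀ hx hxy _) (by linarith)
    push_cast
    calc (q + 1 + 1 : ℝ) * x ^ (q + 1) * (y - x) =
          x * ((q + 1) * x ^ q * (y - x)) + x ^ (q + 1) * (y - x) := by ring
      _ ≤ x * (y ^ (q + 1) - x ^ (q + 1)) + y ^ (q + 1) * (y - x) := add_le_add h1 h2
      _ = y ^ (q + 1 + 1) - x ^ (q + 1 + 1) := by ring

lemma sum_reflect (N : ℕ) (F : ℝ → ℝ) :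
    ∑ k ∈ Finset.range N, F (((N : ℝ) - k) / N) = ∑ j ∈ Finset.range N, F (((j : ℝ) + 1) / N) := by
  rw [← Finset.sum_range_reflect]
  apply sum_congr rfl
  intro j hj
  have hj := mem_range.1 hj
  congr 2
  rw [Nat.cast_sub (by omega), Nat.cast_sub (by omega)]
  push_cast; ring

lemma riem1 (q N : ℕ) (hN : 0 < N) :
    (1 / (N : ℝ)) * ∑ k ∈ Finset.range N, (((N : ℝ) - k) / N) ^ q ≤ 1 / (q + 1) + 1 / N := by
  rw [sum_reflect N (fun s => s ^ q), mul_sum]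
  have hN' : (0:ℝ) < N := by exact_mod_cast hN
  have key : ∀ j ∈ Finset.range N, 1 / (N : ℝ) * (((j : ℝ) + 1) / N) ^ q ≤
      (((1 / (q + 1)) * ((((j + 1 : ℕ) : ℝ)) / N) ^ (q + 1) + 1 / N * (((j + 1 : ℕ) : ℝ) / N) ^ q) -
      ((1 / (q + 1)) * (((j : ℝ)) / N) ^ (q + 1) + 1 / N * ((j : ℝ) / N) ^ q)) := by
    intro j _
    have := le_pow_diff q (x := (j:ℝ) / N) (y := ((j:ℝ) + 1) / N) (by positivity)
      (by gcongr; linarith)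
    have e : ((j:ℝ) + 1) / N - (j:ℝ) / N = 1 / N := by field_simp; ring
    rw [e] at this
    push_cast
    have hq : (0:ℝ) < q + 1 := by positivity
    have h2 : ((j:ℝ) / N) ^ q * (1 / N) ≤ (1 / (q + 1)) * ((((j:ℝ) + 1) / N) ^ (q + 1) - ((j:ℝ) / N) ^ (q + 1)) := by
      rw [one_div_mul_eq_div, le_div_iff₀ hq]
      linarith
    linarith
  refine (sum_le_sum key).trans ?_
  rw [Finset.sum_range_sub (fun j : ℕ => (1 / ((q:ℝ) + 1)) * (((j : ℝ)) / N) ^ (q + 1) + 1 / N * ((j : ℝ) / N) ^ q)]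
  have : (0:ℝ) ≤ 1 / (N:ℝ) * (((0:ℕ):ℝ) / N) ^ q := by positivity
  rw [div_self hN'.ne']
  simp only [one_pow, mul_one, Nat.cast_zero, zero_div] at *
  have h0 : (0:ℝ) ^ (q + 1) = 0 := by simp
  rw [h0]
  linarith

lemma riem2 (q N : ℕ) (hq : 1 ≤ q) (hN : 0 < N) :
    (1 / (N : ℝ)) * ∑ k ∈ Finset.range N, (((N : ℝ) - k) / N) ^ q * Real.log (((N : ℝ) - k) / N)
      ≤ - 1 / (q + 1) ^ 2 + 2 / N := by
  rw [sum_reflect N (fun s => s ^ q * Real.log s), mul_sum]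
  have hN' : (0:ℝ) < N := by exact_mod_cast hN
  have hQ : (0:ℝ) < q + 1 := by positivity
  set G : ℕ → ℝ := fun j => (1 / ((q:ℝ) + 1) ^ 2) * (((j:ℝ) / N) ^ (q + 1) * Real.log (((j:ℝ) / N) ^ (q + 1))
    - ((j:ℝ) / N) ^ (q + 1)) with hGdef
  have key : ∀ j ∈ Finset.range N, 1 / (N : ℝ) * ((((j : ℝ) + 1) / N) ^ q * Real.log (((j : ℝ) + 1) / N)) ≤
      (G (j + 1) - G j) + 2 / N ^ 2 := by
    intro j hj
    have hjN : (j:ℝ) + 1 ≤ N := by exact_mod_cast mem_range.1 hj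
    have hy : 0 < ((j:ℝ) + 1) / N := by positivity
    have hy1 : ((j:ℝ) + 1) / N ≤ 1 := by rw [div_le_one hN']; exact hjN
    rcases Nat.eq_zero_or_pos j with rfl | hjpos
    · rw [Nat.cast_zero, zero_add] at hy hy1
      simp only [hGdef]
      push_cast
      simp only [zero_add, zero_div, ne_eq, Nat.add_eq_zero_iff, one_ne_zero, and_false, not_false_eq_true,
        zero_pow, zero_mul, sub_zero, mul_zero]
      rw [Real.log_pow]
      push_cast
      set y : ℝ := 1 / N with hydef
      have hlog : Real.log y ≤ 0 := Real.log_nonpos hy.le hy1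
      have e1 : 2 / (N:ℝ) ^ 2 = 2 * y ^ 2 := by rw [hydef]; field_simp
      rw [e1]
      have e2 : y ^ (q + 1) ≤ y ^ 2 := pow_le_pow_of_le_one hy.le hy1 (by omega)
      have e3 : 1 / ((q:ℝ) + 1) ^ 2 * (y ^ (q + 1) * ((q + 1) * Real.log y) - y ^ (q + 1))
        = 1 / (q + 1) * (y ^ (q + 1) * Real.log y) - 1 / (q + 1) ^ 2 * y ^ (q + 1) := by
        field_simp
      rw [e3]
      have e4 : y * (y ^ q * Real.log y) = y ^ (q + 1) * Real.log y := by ring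
      rw [e4]
      have hp : 0 ≤ y ^ (q + 1) := by positivity
      have e5 : y ^ (q + 1) * Real.log y ≤ 0 := mul_nonpos_of_nonneg_of_nonpos hp hlog
      have e6 : 1 / ((q:ℝ) + 1) ≤ 1 := by rw [div_le_one hQ]; linarith [Nat.cast_nonneg (α := ℝ) q]
      have e7 : 1 / ((q:ℝ) + 1) ^ 2 ≤ 1 := by
        rw [div_le_one (by positivity)]; nlinarith [Nat.cast_nonneg (α := ℝ) q]
      nlinarith
    · have hj1 : (1:ℝ) ≤ j := by exact_mod_cast hjpos
      simp only [hGdef]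
      push_cast
      set x : ℝ := (j:ℝ) / N with hxdef
      set y : ℝ := ((j:ℝ) + 1) / N with hydef
      have hx : 0 < x := by positivity
      have hyx : y - x = 1 / N := by rw [hxdef, hydef]; field_simp; ring
      have hxy : x ≤ y := by have : (0:ℝ) < 1 / N := by positivity
                             linarith
      have hx1 : x ≤ 1 := hxy.trans hy1
      have hlx : Real.log x ≤ 0 := Real.log_nonpos hx.le hx1
      -- convexity
      have c1 : Real.log (x ^ (q + 1)) * (y ^ (q + 1) - x ^ (q + 1)) ≤
          (y ^ (q + 1) * Real.log (y ^ (q + 1)) - y ^ (q + 1))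
          - (x ^ (q + 1) * Real.log (x ^ (q + 1)) - x ^ (q + 1)) := by
        have hu : 0 < y ^ (q + 1) := by positivity
        have ht : 0 < x ^ (q + 1) := by positivity
        have := Real.log_le_sub_one_of_pos (div_pos ht hu)
        rw [Real.log_div ht.ne' hu.ne'] at this
        have h2 := mul_le_mul_of_nonneg_left this hu.le
        have h3 : y ^ (q + 1) * (x ^ (q + 1) / y ^ (q + 1) - 1) = x ^ (q + 1) - y ^ (q + 1) := by
          field_simp
        rw [h3] at h2
        linarith
      have c2 := pow_diff_le q hx.le hxy
      rw [hyx] at c2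
      rw [Real.log_pow x] at c1
      push_cast at c1
      have c3 : ((q:ℝ) + 1) * Real.log x * ((q + 1) * y ^ q * (1 / N)) ≤
          ((q:ℝ) + 1) * Real.log x * (y ^ (q + 1) - x ^ (q + 1)) := by
        apply mul_le_mul_of_nonpos_left c2
        exact mul_nonpos_of_nonneg_of_nonpos hQ.le hlx
      have c4 : Real.log x * y ^ q * (1 / N) ≤ 1 / ((q:ℝ) + 1) ^ 2 *
          (y ^ (q + 1) * Real.log (y ^ (q + 1)) - y ^ (q + 1)) -
          1 / ((q:ℝ) + 1) ^ 2 * (x ^ (q + 1) * Real.log (x ^ (q + 1)) - x ^ (q + 1)) := by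
        rw [← mul_sub, one_div_mul_eq_div, le_div_iff₀ (by positivity)]
        rw [Real.log_pow x]
        push_cast
        linarith
      have c5 : y ^ q * (Real.log y - Real.log x) ≤ 2 / N := by
        have l1 : Real.log y - Real.log x ≤ 1 / j := by
          rw [← Real.log_div hy.ne' hx.ne']
          have : y / x = 1 + 1 / j := by rw [hxdef, hydef]; field_simp
          rw [this]
          have := Real.log_le_sub_one_of_pos (show (0:ℝ) < 1 + 1 / j by positivity)
          linarith
        have l2 : y ^ q ≤ y := by
          calc y ^ q ≤ y ^ 1 := pow_le_pow_of_le_one hy.le hy1 hq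
            _ = y := pow_one y
        calc y ^ q * (Real.log y - Real.log x) ≤ y * (1 / j) := by
              apply mul_le_mul l2 l1 _ hy.le
              have := Real.log_le_log hx hxy
              linarith
          _ ≤ 2 / N := by
              rw [hydef, div_mul_div_comm, div_le_div_iff₀ (by positivity) hN']
              nlinarith
      have c6 : 2 / (N:ℝ) ^ 2 = 1 / N * (2 / N) := by field_simp
      have c7 : 1 / (N:ℝ) * (y ^ q * (Real.log y - Real.log x)) ≤ 1 / N * (2 / N) :=
        mul_le_mul_of_nonneg_left c5 (by positivity)
      rw [c6]
      rw [Real.log_pow x] at c4 ⊢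
      rw [Real.log_pow y] at c4 ⊢
      nlinarith
  refine (sum_le_sum key).trans ?_
  rw [sum_add_distrib, Finset.sum_range_sub G, sum_const, card_range, nsmul_eq_mul]
  have e1 : (N:ℝ) * (2 / N ^ 2) = 2 / N := by field_simp
  rw [e1]
  have e2 : G N = - 1 / (q + 1) ^ 2 := by
    simp only [hGdef]
    rw [div_self hN'.ne']
    simp; ring
  have e3 : G 0 = 0 := by simp [hGdef]
  rw [e2, e3, sub_zero]

lemma riem3 (q N : ℕ) (hq : 1 ≤ q) (hN : 0 < N) (s0 : ℝ) (hs0 : 0 < s0) :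
    (1 / (N : ℝ)) * ∑ k ∈ Finset.range N, (((N : ℝ) - k) / N) ^ q *
      Real.log (max (((N : ℝ) - k) / N) s0)
      ≤ - 1 / (q + 1) ^ 2 + 2 / N + s0 := by
  have hN' : (0:ℝ) < N := by exact_mod_cast hN
  have key : ∀ k ∈ Finset.range N, (((N : ℝ) - k) / N) ^ q *
      Real.log (max (((N : ℝ) - k) / N) s0) ≤ (((N : ℝ) - k) / N) ^ q * Real.log (((N : ℝ) - k) / N) + s0 := by
    intro k hk
    have hk : (k : ℝ) < N := by exact_mod_cast mem_range.1 hk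
    set s : ℝ := ((N : ℝ) - k) / N with hs
    have h0 : 0 < s := div_pos (by linarith) hN'
    have h1 : s ≤ 1 := by
      rw [hs, div_le_one hN']
      linarith [Nat.cast_nonneg (α := ℝ) k]
    rcases le_total s0 s with h | h
    · rw [max_eq_left h]; linarith
    · rw [max_eq_right h]
      have := Real.log_le_sub_one_of_pos (div_pos hs0 h0)
      rw [Real.log_div hs0.ne' h0.ne'] at this
      have hsq : s ^ q ≤ s := by
        calc s ^ q ≤ s ^ 1 := pow_le_pow_of_le_one h0.le h1 hq
          _ = s := pow_one s
      have h3 : Real.log s0 - Real.log s ≤ s0 / s := by linarith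
      have h4 : s ^ q * (Real.log s0 - Real.log s) ≤ s * (s0 / s) := by
        apply mul_le_mul hsq h3 _ h0.le
        have := Real.log_le_log h0 h
        linarith
      have h5 : s * (s0 / s) = s0 := by field_simp
      linarith
  have h1 := mul_le_mul_of_nonneg_left (sum_le_sum key) (show 0 ≤ 1 / (N:ℝ) by positivity)
  rw [sum_add_distrib, sum_const, card_range, nsmul_eq_mul, mul_add] at h1
  have h2 := riem2 q N hq hN
  have h3 : 1 / (N:ℝ) * (N * s0) = s0 := by field_simp
  linarith

lemma le_of_forall_div {L X Y : ℝ} (h : ∀ N : ℕ, 0 < N → L ≤ X + Y / N) : L ≤ X := by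
  have h1 : Filter.Tendsto (fun N : ℕ => X + Y / (N : ℝ)) Filter.atTop (nhds (X + 0)) :=
    tendsto_const_nhds.add (tendsto_const_div_atTop_nhds_zero_nat Y)
  rw [add_zero] at h1
  refine ge_of_tendsto h1 ?_
  filter_upwards [Filter.eventually_gt_atTop 0] with N hN
  exact h N hN

lemma sum_matchings {W : Finset ℕ} {H : Finset (Finset ℕ)} (hW : ∀ A ∈ H, A ⊆ W ∧ A.Nonempty)
    (g : Finset ℕ → ℝ) :
    ∑ M ∈ pmSet W H, ∑ B ∈ M, g B = ∑ A ∈ H, (phiSub W H A : ℝ) * g A := by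
  have h1 : ∀ M ∈ pmSet W H, ∑ B ∈ M, g B = ∑ A ∈ H, if A ∈ M then g A else 0 := by
    intro M hM
    rw [← sum_filter]
    congr 1
    ext A
    simp only [mem_filter]
    exact ⟨fun h => ⟨(mem_pmSet.1 hM).1 h, h⟩, fun h => h.2⟩
  rw [sum_congr rfl h1, sum_comm]
  apply sum_congr rfl
  intro A hA
  rw [← sum_filter, pm_sum_through W H A hA (hW A hA).1 (hW A hA).2 (fun _ => g A), sum_const,
    nsmul_eq_mul]
  rfl

lemma summand_bound {r : ℕ} (hr : 2 ≤ r) {n Dw D S Bd δ s s0 : ℝ} (hn : 0 < n) (hDw : 0 < Dw)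
    (hS : r * S = n * Dw) (hD : D ≤ Dw) (hδ : 0 ≤ δ) (hB : Bd ≤ r * n * (δ * D))
    (hs : 0 < s) (hs0 : 0 < s0) :
    n * (Real.log (Dw * (max s s0) ^ (r * (r - 1))) - 1) * s ^ (r - 1)
     + 1 / (Dw * (max s s0) ^ (r * (r - 1))) * (r * (s ^ (r * r - 1) * S + s ^ (r - 1) * (2 * Bd)))
    ≤ n * (s ^ (r - 1) * (Real.log Dw + 2 * r ^ 2 * δ / s0 ^ (r * (r - 1)))
        + (r * (r - 1) : ℕ) * (s ^ (r - 1) * Real.log (max s s0))) := by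
  set a := r * (r - 1) with ha
  have har : r * r - 1 = (r - 1) + a := by
    obtain ⟨q, rfl⟩ : ∃ q, r = q + 1 := ⟨r - 1, by omega⟩
    simp only [ha, Nat.add_sub_cancel]
    have : (q + 1) * (q + 1) = q + (q + 1) * q + 1 := by ring
    omega
  have hm : 0 < max s s0 := lt_max_of_lt_left hs
  have hma : 0 < (max s s0) ^ a := by positivity
  have hsa : s ^ a ≤ (max s s0) ^ a := pow_le_pow_left₀ hs.le (le_max_left _ _) _
  have hs0a : s0 ^ a ≤ (max s s0) ^ a := pow_le_pow_left₀ hs0.le (le_max_right _ _) _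
  have hs0p : 0 < s0 ^ a := by positivity
  have hsq : 0 < s ^ (r - 1) := by positivity
  rw [Real.log_mul hDw.ne' hma.ne', Real.log_pow]
  have t1 : 1 / (Dw * (max s s0) ^ a) * (r * (s ^ (r * r - 1) * S)) ≤ n * s ^ (r - 1) := by
    rw [har, pow_add, one_div_mul_eq_div, div_le_iff₀ (by positivity)]
    have : (r:ℝ) * (s ^ (r - 1) * s ^ a * S) = n * s ^ (r - 1) * (Dw * s ^ a) := by
      calc _ = s ^ (r - 1) * s ^ a * (r * S) := by ring
        _ = _ := by rw [hS]; ring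
    rw [this]
    gcongr
  have t2 : 1 / (Dw * (max s s0) ^ a) * (r * (s ^ (r - 1) * (2 * Bd))) ≤
      n * (s ^ (r - 1) * (2 * r ^ 2 * δ / s0 ^ a)) := by
    have hb2 : Bd ≤ r * n * (δ * Dw) := hB.trans (by gcongr)
    have e : n * (s ^ (r - 1) * (2 * r ^ 2 * δ / s0 ^ a)) =
        (r * (s ^ (r - 1) * (2 * (r * n * (δ * Dw))))) / (Dw * s0 ^ a) := by
      field_simp
    rw [e, one_div_mul_eq_div]
    have h0 : 0 ≤ (r * (s ^ (r - 1) * (2 * (r * n * (δ * Dw))))) := by positivity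
    gcongr
  calc _ = n * (Real.log Dw + a * Real.log (max s s0) - 1) * s ^ (r - 1) +
        (1 / (Dw * (max s s0) ^ a) * (r * (s ^ (r * r - 1) * S)) +
        1 / (Dw * (max s s0) ^ a) * (r * (s ^ (r - 1) * (2 * Bd)))) := by ring
    _ ≤ n * (Real.log Dw + a * Real.log (max s s0) - 1) * s ^ (r - 1) +
        (n * s ^ (r - 1) + n * (s ^ (r - 1) * (2 * r ^ 2 * δ / s0 ^ a))) := by gcongr
    _ = _ := by ring

lemma main_ineq {n r : ℕ} (hn : 0 < n) (hr2 : 2 ≤ r) {H : Finset (Finset ℕ)} (hH : H ⊆ Kn n r)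
    (w : Finset ℕ → ℝ) (hw1 : ∀ A, 1 ≤ w A) (hw2 : ∀ A, w A ≤ 2) {δ : ℝ} (hδ : 0 ≤ δ)
    (hcod : ∀ x ∈ Finset.range n, ∀ y ∈ Finset.range n, x ≠ y →
      (codeg H x y : ℝ) ≤ δ * avgDeg r (Finset.range n) H)
    {Dw : ℝ} (hDw : Dw = r * (∑ A ∈ H, w A) / n) (hDw1 : 1 ≤ Dw) {s0 : ℝ} (hs0 : 0 < s0) :
    (pmCount (Finset.range n) H : ℝ) * Real.log (pmCount (Finset.range n) H)
      + ∑ A ∈ H, (phiSub (Finset.range n) H A : ℝ) * Real.log (w A)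
    ≤ (pmCount (Finset.range n) H : ℝ) * (n * ((1 / r) * Real.log Dw - (r - 1) / r
        + 2 * r ^ 2 * δ / s0 ^ (r * (r - 1)) + (r * (r - 1) : ℕ) * s0)) := by
  have hn' : (0:ℝ) < n := by exact_mod_cast hn
  have hr' : (0:ℝ) < r := by have : 0 < r := by omega
                             exact_mod_cast this
  have hw : ∀ A, 0 < w A := fun A => lt_of_lt_of_le one_pos (hw1 A)
  have hHr : ∀ A ∈ H, A.card = r := fun A hA => (mem_powersetCard.1 (hH hA)).2
  have hHW : ∀ A ∈ H, A ⊆ Finset.range n := fun A hA => (mem_powersetCard.1 (hH hA)).1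
  have hG : ∀ A ∈ H, A ⊆ Finset.range n ∧ A.Nonempty := fun A hA =>
    ⟨hHW A hA, card_pos.1 (by rw [hHr A hA]; omega)⟩
  have hD0 : 0 ≤ avgDeg r (Finset.range n) H := by unfold avgDeg; positivity
  have hDDw : avgDeg r (Finset.range n) H ≤ Dw := by
    rw [hDw, avgDeg, card_range]
    gcongr
    rw [card_eq_sum_ones]
    push_cast
    exact sum_le_sum fun A _ => hw1 A
  have hDw0 : 0 < Dw := by linarith
  have hlD : 0 ≤ Real.log Dw := Real.log_nonneg hDw1
  have hS : r * (∑ A ∈ H, w A) = n * Dw := by rw [hDw]; field_simp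
  set a : ℕ := r * (r - 1) with ha
  set β : ℝ := 2 * r ^ 2 * δ / s0 ^ a with hβ
  have hβ0 : 0 ≤ β := by positivity
  set Φ : ℝ := (pmCount (Finset.range n) H : ℝ) with hΦ
  have hΦ0 : 0 ≤ Φ := Nat.cast_nonneg _
  apply le_of_forall_div (Y := Φ * (n * (Real.log Dw + β + 2 * a)))
  intro N hN
  have hN' : (0:ℝ) < N := by exact_mod_cast hN
  set c : ℕ → ℝ := fun k => Dw * (max (((N : ℝ) - k) / N) s0) ^ a with hcdef
  have hc : ∀ k, 0 < c k := fun k => by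
    have : 0 < max (((N : ℝ) - k) / N) s0 := lt_max_of_lt_right hs0
    simp only [hcdef]
    positivity
  have hsum := sum_le_sum (s := (Finset.univ : Finset (Fin n → Fin N)))
    (fun f _ => order_bound w hw (kap f) (Finset.range n) H hG (kap_inj f))
  rw [sum_const, nsmul_eq_mul, sum_comm] at hsum
  have hcard : ((Finset.univ : Finset (Fin n → Fin N)).card : ℝ) = (N:ℝ) ^ n := by
    simp
  rw [hcard] at hsum
  have hM : ∀ M ∈ pmSet (Finset.range n) H,
      ∑ f : Fin n → Fin N, ((∑ v ∈ Fs (Finset.range n) (kap f) M, Real.log (Nv H w (kap f) M v))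
        - ∑ B ∈ M, Real.log (w B)) ≤
      (N:ℝ) ^ n * (n * ((1 / r) * Real.log Dw - (r - 1) / r + β + a * s0)
        + n * (Real.log Dw + β + 2 * a) / N - ∑ B ∈ M, Real.log (w B)) := by
    intro M hM
    rw [sum_sub_distrib, sum_const, nsmul_eq_mul, hcard, mul_sub]
    apply sub_le_sub_right
    refine (avg_bound hN (by omega) hM hHW hHr w hw1 hw2 c hc).trans ?_
    apply mul_le_mul_of_nonneg_left _ (by positivity)
    have hBad : ((Bad H M).card : ℝ) ≤ r * n * (δ * avgDeg r (Finset.range n) H) := by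
      have := Bad_card hM hHr (mul_nonneg hδ hD0) hcod
      rwa [card_range] at this
    have hterm : ∀ k ∈ Finset.range N, _ := fun k hk => summand_bound hr2 hn' hDw0 hS hDDw hδ hBad
      (show 0 < ((N:ℝ) - k) / N from div_pos (by
        have : (k : ℝ) < N := by exact_mod_cast mem_range.1 hk
        linarith) hN') hs0
    have h1 := mul_le_mul_of_nonneg_left (sum_le_sum hterm) (show 0 ≤ 1 / (N:ℝ) by positivity)
    refine h1.trans ?_
    rw [← mul_sum, sum_add_distrib, ← sum_mul, ← mul_sum]
    have hq : ((r - 1 : ℕ) : ℝ) + 1 = r := by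
      rw [Nat.cast_sub (by omega)]; push_cast; ring
    have R1 := riem1 (r - 1) N hN
    have R3 := riem3 (r - 1) N (by omega) hN s0 hs0
    rw [hq] at R1 R3
    have R1' := mul_le_mul_of_nonneg_right R1 (add_nonneg hlD hβ0)
    have R3' := mul_le_mul_of_nonneg_left R3 (Nat.cast_nonneg (α := ℝ) a)
    have ea : (a:ℝ) = r * (r - 1) := by
      rw [ha]; push_cast [Nat.cast_sub (show 1 ≤ r by omega)]; ring
    have e1 : (a:ℝ) * (-1 / r ^ 2 + 2 / N + s0) = - (r - 1) / r + 2 * a / N + a * s0 := by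
      rw [ea]; field_simp
    rw [e1] at R3'
    have e2 : 1 / (r:ℝ) * β ≤ β := by
      have : 1 / (r:ℝ) ≤ 1 := by
        rw [div_le_one hr']
        have : 1 ≤ r := by omega
        exact_mod_cast this
      nlinarith
    have e3 : n * ((1 / r) * Real.log Dw - (r - 1) / r + β + a * s0)
        + n * (Real.log Dw + β + 2 * a) / N = n * ((1 / r) * Real.log Dw - (r - 1) / r + β + a * s0
        + (Real.log Dw + β + 2 * a) / N) := by ring
    rw [e3, mul_left_comm]
    apply mul_le_mul_of_nonneg_left _ hn'.le
    have e4 : (1 / (r:ℝ) + 1 / N) * (Real.log Dw + β) = 1 / r * Real.log Dw + 1 / r * β + (Real.log Dw + β) / N := by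
      ring
    have e5 : (Real.log Dw + β + 2 * a) / N = (Real.log Dw + β) / N + 2 * a / N := by ring
    rw [e4] at R1'
    rw [e5, mul_add]
    have e6 : - ((r:ℝ) - 1) / r = -((r - 1) / r) := by ring
    rw [e6] at R3'
    linarith
  have h2 := hsum.trans (sum_le_sum hM)
  rw [← mul_sum] at h2
  have h3 := le_of_mul_le_mul_left h2 (show 0 < (N:ℝ) ^ n by positivity)
  rw [sum_sub_distrib, sum_const, nsmul_eq_mul, sum_matchings hG (fun A => Real.log (w A))] at h3
  have h4 : ((pmSet (Finset.range n) H).card : ℝ) = Φ := rfl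
  rw [h4] at h3
  have e : Φ * (n * ((1 / r) * Real.log Dw - (r - 1) / r + β + a * s0)) +
    Φ * (n * (Real.log Dw + β + 2 * a)) / N = Φ * (n * ((1 / r) * Real.log Dw - (r - 1) / r + β + a * s0)
        + n * (Real.log Dw + β + 2 * a) / N) := by ring
  rw [e]
  linarith

lemma log_fact_lower (k : ℕ) : (k : ℝ) * Real.log k - k ≤ Real.log (k.factorial) := by
  induction k with
  | zero => simp
  | succ k ih =>
    rw [Nat.factorial_succ, Nat.cast_mul, Real.log_mul (by positivity) (by positivity)]
    rcases Nat.eq_zero_or_pos k with rfl | hk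
    · simp
    have hk' : (0:ℝ) < k := by exact_mod_cast hk
    have := Real.log_le_sub_one_of_pos (show (0:ℝ) < ((k + 1 : ℕ) : ℝ) / k by positivity)
    rw [Real.log_div (by positivity) hk'.ne'] at this
    have h2 := mul_le_mul_of_nonneg_left this hk'.le
    have h3 : (k:ℝ) * (((k + 1 : ℕ) : ℝ) / k - 1) = 1 := by push_cast; field_simp; ring
    rw [h3] at h2
    push_cast at *
    linarith

lemma log_fact_upper (k : ℕ) (hk : 1 ≤ k) :
    Real.log (k.factorial) ≤ (k : ℝ) * Real.log k - k + 1 + Real.log k := by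
  induction k, hk using Nat.le_induction with
  | base => simp
  | succ k hk ih =>
    rw [Nat.factorial_succ, Nat.cast_mul, Real.log_mul (by positivity) (by positivity)]
    have hk' : (0:ℝ) < k := by exact_mod_cast hk
    have := Real.log_le_sub_one_of_pos (show (0:ℝ) < (k : ℝ) / ((k + 1 : ℕ) : ℝ) by positivity)
    rw [Real.log_div hk'.ne' (by positivity)] at this
    have h2 := mul_le_mul_of_nonneg_left this (show (0:ℝ) ≤ ((k + 1 : ℕ) : ℝ) by positivity)
    have h3 : ((k + 1 : ℕ) : ℝ) * ((k : ℝ) / ((k + 1 : ℕ) : ℝ) - 1) = -1 := by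
      push_cast; field_simp; ring
    rw [h3] at h2
    push_cast at *
    linarith

lemma harm_bound (C : ℝ) (t : ℕ) (h : (t : ℝ) < C) :
    ∑ i ∈ Finset.Icc 1 t, 1 / (C - (i : ℝ) + 1) ≤ Real.log C - Real.log (C - t) := by
  induction t with
  | zero => simp
  | succ t ih =>
    push_cast at h
    rw [Finset.sum_Icc_succ_top (by omega)]
    have := ih (by linarith)
    have hx : 0 < C - t := by linarith
    have hx1 : 0 < C - t - 1 := by linarith
    have h1 := Real.log_le_sub_one_of_pos (div_pos hx1 hx)
    rw [Real.log_div hx1.ne' hx.ne'] at h1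
    have h2 : (C - t - 1) / (C - t) - 1 = - (1 / (C - t)) := by field_simp; ring
    rw [h2] at h1
    push_cast
    have e1 : C - ((t:ℝ) + 1) + 1 = C - t := by ring
    have e2 : C - ((t:ℝ) + 1) = C - t - 1 := by ring
    rw [e1, e2]
    linarith

lemma A_lower {r k : ℕ} (hr : 1 ≤ r) (hk : 1 ≤ k) {H : Finset (Finset ℕ)} {δ : ℝ}
    (hm : 0 < H.card) (hmC : H.card ≤ (r * k).choose r) (hA : propA r (r * k) H δ) :
    (k : ℝ) * (Real.log H.card - Real.log k - (r - 1)) - δ * (r * k) - 1 - Real.log k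
      < Real.log (pmCount (Finset.range (r * k)) H) := by
  unfold propA at hA
  have hr' : (0:ℝ) < r := by exact_mod_cast hr
  have hk' : (0:ℝ) < k := by exact_mod_cast hk
  rw [Nat.mul_div_cancel_left k (by omega)] at hA
  have hm' : (0:ℝ) < H.card := by exact_mod_cast hm
  have hγ : ∑ i ∈ Finset.Icc 1 ((r * k).choose r - H.card),
        (((r * k : ℕ) : ℝ) / r) / (((r * k).choose r : ℝ) - (i : ℝ) + 1)
      ≤ k * (Real.log ((r * k).choose r) - Real.log H.card) := by
    have := harm_bound ((r * k).choose r : ℝ) ((r * k).choose r - H.card) (by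
      rw [Nat.cast_sub hmC]; linarith)
    rw [Nat.cast_sub hmC, sub_sub_cancel] at this
    refine le_trans (le_of_eq ?_) (mul_le_mul_of_nonneg_left this hk'.le)
    rw [mul_sum]
    apply sum_congr rfl
    intro i _
    have : ((r * k : ℕ) : ℝ) / r = k := by push_cast; field_simp
    rw [this]; ring
  have hC0 : 0 < (r * k).choose r := lt_of_lt_of_le hm hmC
  have hC : Real.log ((r * k).choose r) ≤ r * Real.log ((r * k : ℕ) : ℝ) - Real.log (r.factorial) := by
    have h1 : ((r * k).choose r : ℝ) ≤ ((r * k : ℕ) : ℝ) ^ r / (r.factorial : ℝ) :=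
      Nat.choose_le_pow_div r (r * k)
    have h2 := Real.log_le_log (by exact_mod_cast hC0) h1
    rwa [Real.log_div (by positivity) (by positivity), Real.log_pow] at h2
  rw [Real.log_div (by positivity) (by positivity), Real.log_mul (by positivity) (by positivity),
    Real.log_pow] at hA
  have f1 := log_fact_lower (r * k)
  have f2 := log_fact_upper k hk
  have hC' := mul_le_mul_of_nonneg_left hC hk'.le
  push_cast at *
  nlinarith

lemma core {n r : ℕ} (hn : 0 < n) (hr2 : 2 ≤ r) {H : Finset (Finset ℕ)} (hH : H ⊆ Kn n r)
    {δ : ℝ} (hδ : 0 ≤ δ) (hm : 0 < H.card)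
    (hcod : ∀ x ∈ Finset.range n, ∀ y ∈ Finset.range n, x ≠ y →
      (codeg H x y : ℝ) ≤ δ * avgDeg r (Finset.range n) H)
    (hD1 : 1 ≤ avgDeg r (Finset.range n) H) {s0 ξ η : ℝ} (hs0 : 0 < s0)
    (hlow : (n / r : ℝ) * (Real.log (avgDeg r (Finset.range n) H) - (r - 1)) - ξ * n
      ≤ Real.log (pmCount (Finset.range n) H))
    (hη : 2 * r ^ 2 * δ / s0 ^ (r * (r - 1)) + (r * (r - 1) : ℕ) * s0 + ξ ≤ η)
    (w : Finset ℕ → ℝ) (hw1 : ∀ A, 1 ≤ w A) (hw2 : ∀ A, w A ≤ 2) :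
    ∑ A ∈ H, (phiSub (Finset.range n) H A : ℝ) * Real.log (w A)
    ≤ (pmCount (Finset.range n) H : ℝ) * (n * ((1 / r) * Real.log ((∑ A ∈ H, w A) / H.card) + η)) := by
  have hn' : (0:ℝ) < n := by exact_mod_cast hn
  have hm' : (0:ℝ) < H.card := by exact_mod_cast hm
  have hr' : (0:ℝ) < r := by have : 0 < r := by omega
                             exact_mod_cast this
  have hSm : (H.card : ℝ) ≤ ∑ A ∈ H, w A := by
    rw [card_eq_sum_ones]
    push_cast
    exact sum_le_sum fun A _ => hw1 A
  have hS : 0 < ∑ A ∈ H, w A := by linarith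
  have hDeq : avgDeg r (Finset.range n) H = r * H.card / n := by rw [avgDeg, card_range]
  have hDw : r * (∑ A ∈ H, w A) / n = avgDeg r (Finset.range n) H * ((∑ A ∈ H, w A) / H.card) := by
    rw [hDeq]; field_simp
  have hDw1 : 1 ≤ r * (∑ A ∈ H, w A) / n := by
    refine hD1.trans ?_
    rw [hDeq]
    gcongr
  have hmain := main_ineq hn hr2 hH w hw1 hw2 hδ hcod rfl hDw1 hs0
  rw [hDw, Real.log_mul (by linarith) (by positivity)] at hmain
  set Φ : ℝ := (pmCount (Finset.range n) H : ℝ) with hΦ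
  have hΦ0 : 0 ≤ Φ := Nat.cast_nonneg _
  have h1 := mul_le_mul_of_nonneg_left hlow hΦ0
  have h2 := mul_le_mul_of_nonneg_left hη (mul_nonneg hΦ0 hn'.le)
  set Y := 2 * r ^ 2 * δ / s0 ^ (r * (r - 1))
  set Z := ((r * (r - 1) : ℕ) : ℝ) * s0
  set ld := Real.log (avgDeg r (Finset.range n) H)
  have e1 : Φ * ((n / r : ℝ) * (ld - (r - 1)) - ξ * n) =
    Φ * (n * ((1 / r) * ld - (r - 1) / r)) - Φ * n * ξ := by ring
  rw [e1] at h1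
  nlinarith

lemma sum_phi {n r : ℕ} (hr : 1 ≤ r) {H : Finset (Finset ℕ)} (hH : H ⊆ Kn n r) :
    ∑ A ∈ H, (phiSub (Finset.range n) H A : ℝ) = pmCount (Finset.range n) H * (n / r) := by
  have hHr : ∀ A ∈ H, A.card = r := fun A hA => (mem_powersetCard.1 (hH hA)).2
  have hHW : ∀ A ∈ H, A ⊆ Finset.range n := fun A hA => (mem_powersetCard.1 (hH hA)).1
  have hG : ∀ A ∈ H, A ⊆ Finset.range n ∧ A.Nonempty := fun A hA =>
    ⟨hHW A hA, card_pos.1 (by rw [hHr A hA]; omega)⟩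
  have h := sum_matchings hG (fun _ => 1)
  simp only [mul_one] at h
  rw [← h, pmCount, ← nsmul_eq_mul, ← sum_const]
  apply sum_congr rfl
  intro M hM
  have hWc : (Finset.range n).card = M.card * r := by
    conv_lhs => rw [← (mem_pmSet.1 hM).2.2]
    rw [card_biUnion]
    · exact sum_const_nat fun B hB => hHr B ((mem_pmSet.1 hM).1 hB)
    · intro B hB C hC hBC
      exact disjoint_iff_inter_eq_empty.2 ((mem_pmSet.1 hM).2.1 B hB C hC hBC)
  rw [card_range] at hWc
  have hr' : (0:ℝ) < r := by exact_mod_cast hr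
  rw [hWc]
  push_cast
  simp
  field_simp

/-- Extracting the conclusion from the family of inequalities. -/
lemma dev_S {H : Finset (Finset ℕ)} (p : Finset ℕ → ℝ) {Φ n r D η σ τ : ℝ} (hm : 0 < H.card)
    (hΦ : 0 < Φ) (hn : 0 < n) (hr : 0 < r) (hD : D = r * H.card / n) (hτ : 0 < τ) (hτ1 : τ ≤ 1)
    (hσ : 0 < σ) (hτ4 : 4 * τ ≤ σ) (hτ5 : 4 * τ ≤ 1)
    (h : ∀ w : Finset ℕ → ℝ, (∀ A, 1 ≤ w A) → (∀ A, w A ≤ 2) →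
      ∑ A ∈ H, p A * Real.log (w A) ≤ Φ * (n * ((1 / r) * Real.log ((∑ A ∈ H, w A) / H.card) + η))) :
    ((H.filter (fun A => (1 + σ) * Φ / D < p A)).card : ℝ) * (τ * σ / 2) ≤ r * H.card * η := by
  set S := H.filter (fun A => (1 + σ) * Φ / D < p A) with hS
  have hm' : (0:ℝ) < H.card := by exact_mod_cast hm
  have hDpos : 0 < D := by rw [hD]; positivity
  have h1 := h (fun A => if A ∈ S then 1 + τ else 1)
    (fun A => by split_ifs <;> linarith) (fun A => by split_ifs <;> linarith)
  have hlogp : 0 < Real.log (1 + τ) := Real.log_pos (by linarith)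
  have hfS : H.filter (fun A => A ∈ S) = S := by
    ext A; simp only [hS, mem_filter]; tauto
  have e1 : ∑ A ∈ H, p A * Real.log (if A ∈ S then 1 + τ else 1) = (∑ A ∈ S, p A) * Real.log (1 + τ) := by
    rw [sum_mul]
    conv_rhs => rw [← hfS]
    rw [sum_filter]
    apply sum_congr rfl
    intro A _
    split_ifs <;> simp
  have e2 : ∑ A ∈ H, (if A ∈ S then 1 + τ else 1) = H.card + τ * S.card := by
    have : ∀ A ∈ H, (if A ∈ S then 1 + τ else 1) = 1 + (if A ∈ S then τ else 0) := by
      intro A _; split_ifs <;> simp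
    rw [sum_congr rfl this, sum_add_distrib, ← sum_filter, hfS]
    simp [mul_comm]
  rw [e1, e2] at h1
  have e3 : Real.log ((H.card + τ * S.card) / H.card) ≤ τ * S.card / H.card := by
    have := Real.log_le_sub_one_of_pos (show (0:ℝ) < (H.card + τ * S.card) / H.card by positivity)
    have e : ((H.card:ℝ) + τ * S.card) / H.card - 1 = τ * S.card / H.card := by field_simp; ring
    linarith
  have e4 : (S.card : ℝ) * ((1 + σ) * Φ / D) ≤ ∑ A ∈ S, p A := by
    rw [← nsmul_eq_mul, ← sum_const]
    exact sum_le_sum fun A hA => (mem_filter.1 hA).2.le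
  have e5 : τ * (1 - τ) ≤ Real.log (1 + τ) := by
    have := Real.one_sub_inv_le_log_of_pos (show 0 < 1 + τ by linarith)
    have h2 : τ * (1 - τ) ≤ 1 - (1 + τ)⁻¹ := by
      have : 1 - (1 + τ)⁻¹ = τ / (1 + τ) := by field_simp; ring
      rw [this, le_div_iff₀ (by linarith)]
      nlinarith [pow_pos hτ 3]
    linarith
  have e6 : (S.card : ℝ) * ((1 + σ) * Φ / D) * (τ * (1 - τ)) ≤
      Φ * (n * ((1 / r) * (τ * S.card / H.card) + η)) := by
    calc _ ≤ (∑ A ∈ S, p A) * Real.log (1 + τ) := by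
            apply mul_le_mul e4 e5 (by nlinarith)
            exact le_trans (by positivity) e4
      _ ≤ _ := h1
      _ ≤ _ := by gcongr
  have e7 : (S.card : ℝ) * ((1 + σ) * Φ / D) * (τ * (1 - τ)) =
      Φ * n / (r * H.card) * (S.card * (1 + σ) * (τ * (1 - τ))) := by
    rw [hD]; field_simp
  have e8 : Φ * (n * ((1 / r) * (τ * S.card / H.card) + η)) =
      Φ * n / (r * H.card) * (τ * S.card + r * H.card * η) := by
    field_simp
  rw [e7, e8] at e6
  have e9 := le_of_mul_le_mul_left e6 (by positivity)
  have hSc : (0:ℝ) ≤ S.card := Nat.cast_nonneg _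
  have e10 : τ * σ / 2 ≤ (1 + σ) * (τ * (1 - τ)) - τ := by
    have : (1 + σ) * (τ * (1 - τ)) - τ - τ * σ / 2 = τ * (σ / 2 - τ - σ * τ) := by ring
    have h3 : 0 ≤ σ / 2 - τ - σ * τ := by nlinarith
    nlinarith [mul_nonneg hτ.le h3]
  have e11 := mul_le_mul_of_nonneg_left e10 hSc
  linarith

lemma dev_T {H : Finset (Finset ℕ)} (p : Finset ℕ → ℝ) (hp : ∀ A, 0 ≤ p A)
    {Φ n r D η σ τ : ℝ} (hm : 0 < H.card) (hη : 0 ≤ η)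
    (hΦ : 0 < Φ) (hn : 0 < n) (hr : 0 < r) (hD : D = r * H.card / n) (hτ : 0 < τ) (hτ1 : τ ≤ 1)
    (hσ : 0 < σ) (hτ4 : 4 * τ ≤ σ) (hsum : ∑ A ∈ H, p A = Φ * (n / r))
    (h : ∀ w : Finset ℕ → ℝ, (∀ A, 1 ≤ w A) → (∀ A, w A ≤ 2) →
      ∑ A ∈ H, p A * Real.log (w A) ≤ Φ * (n * ((1 / r) * Real.log ((∑ A ∈ H, w A) / H.card) + η))) :
    ((H.filter (fun A => p A < (1 - σ) * Φ / D)).card : ℝ) * (τ * σ / 2) ≤ r * H.card * η := by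
  set T := H.filter (fun A => p A < (1 - σ) * Φ / D) with hT
  have hm' : (0:ℝ) < H.card := by exact_mod_cast hm
  have hDpos : 0 < D := by rw [hD]; positivity
  by_cases hσ1 : 1 < σ
  · have : T = ∅ := by
      rw [hT, filter_eq_empty_iff]
      intro A _
      rw [not_lt]
      refine le_trans ?_ (hp A)
      apply div_nonpos_of_nonpos_of_nonneg _ hDpos.le
      nlinarith
    rw [this]
    simp
    positivity
  push Not at hσ1
  have h1 := h (fun A => if A ∈ T then 1 else 1 + τ)
    (fun A => by split_ifs <;> linarith) (fun A => by split_ifs <;> linarith)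
  have hlogp : 0 < Real.log (1 + τ) := Real.log_pos (by linarith)
  have hfT : H.filter (fun A => A ∈ T) = T := by
    ext A; simp only [hT, mem_filter]; tauto
  have e1 : ∑ A ∈ H, p A * Real.log (if A ∈ T then 1 else 1 + τ)
      = (Φ * (n / r) - ∑ A ∈ T, p A) * Real.log (1 + τ) := by
    have : ∀ A ∈ H, p A * Real.log (if A ∈ T then 1 else 1 + τ) =
        (p A - if A ∈ T then p A else 0) * Real.log (1 + τ) := by
      intro A _
      split_ifs <;> simp
    rw [sum_congr rfl this, ← sum_mul, sum_sub_distrib, ← sum_filter, hfT, hsum]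
  have e2 : ∑ A ∈ H, (if A ∈ T then 1 else 1 + τ) = (1 + τ) * H.card - τ * T.card := by
    have : ∀ A ∈ H, (if A ∈ T then 1 else 1 + τ) = (1 + τ) - (if A ∈ T then τ else 0) := by
      intro A _; split_ifs <;> simp
    rw [sum_congr rfl this, sum_sub_distrib, ← sum_filter, hfT]
    simp [mul_comm]; ring
  rw [e1, e2] at h1
  have hTH : (T.card : ℝ) ≤ H.card := by exact_mod_cast card_le_card (filter_subset _ _)
  have hTc : (0:ℝ) ≤ T.card := Nat.cast_nonneg _
  have hx : 0 < (1 + τ) * H.card - τ * T.card := by nlinarith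
  have e3 : Real.log (((1 + τ) * H.card - τ * T.card) / H.card) ≤
      Real.log (1 + τ) - τ / (1 + τ) * T.card / H.card := by
    have := Real.log_le_sub_one_of_pos (div_pos (div_pos hx hm') (show 0 < 1 + τ by linarith))
    rw [Real.log_div (div_pos hx hm').ne' (by linarith)] at this
    have e : ((1 + τ) * H.card - τ * T.card) / H.card / (1 + τ) - 1 = - (τ / (1 + τ) * T.card / H.card) := by
      field_simp; ring
    linarith
  have e4 : ∑ A ∈ T, p A ≤ (T.card : ℝ) * ((1 - σ) * Φ / D) := by
    rw [← nsmul_eq_mul, ← sum_const]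
    exact sum_le_sum fun A hA => (mem_filter.1 hA).2.le
  have e5 : Real.log (1 + τ) ≤ τ := by
    have := Real.log_le_sub_one_of_pos (show 0 < 1 + τ by linarith)
    linarith
  have e5' : τ * (1 - τ) ≤ τ / (1 + τ) := by
    rw [le_div_iff₀ (by linarith)]
    nlinarith [pow_pos hτ 3]
  have hq0 : 0 ≤ (1 - σ) * Φ / D := by
    apply div_nonneg _ hDpos.le
    nlinarith
  have e6 : (Φ * (n / r) * Real.log (1 + τ) - (T.card : ℝ) * ((1 - σ) * Φ / D) * τ) ≤
      Φ * (n * ((1 / r) * (Real.log (1 + τ) - τ * (1 - τ) * T.card / H.card) + η)) := by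
    calc _ ≤ (Φ * (n / r) - ∑ A ∈ T, p A) * Real.log (1 + τ) := by
            have : (∑ A ∈ T, p A) * Real.log (1 + τ) ≤ (T.card : ℝ) * ((1 - σ) * Φ / D) * τ :=
              mul_le_mul e4 e5 hlogp.le (by positivity)
            linarith
      _ ≤ _ := h1
      _ ≤ Φ * (n * ((1 / r) * (Real.log (1 + τ) - τ / (1 + τ) * T.card / H.card) + η)) := by gcongr
      _ ≤ _ := by gcongr
  have e7 : (Φ * (n / r) * Real.log (1 + τ) - (T.card : ℝ) * ((1 - σ) * Φ / D) * τ) =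
      Φ * n / (r * H.card) * (H.card * Real.log (1 + τ) - T.card * (1 - σ) * τ) := by
    rw [hD]; field_simp
  have e8 : Φ * (n * ((1 / r) * (Real.log (1 + τ) - τ * (1 - τ) * T.card / H.card) + η)) =
      Φ * n / (r * H.card) * (H.card * Real.log (1 + τ) - τ * (1 - τ) * T.card + r * H.card * η) := by
    field_simp
  rw [e7, e8] at e6
  have e9 := le_of_mul_le_mul_left e6 (by positivity)
  have e10 : τ * σ / 2 ≤ τ * (1 - τ) - (1 - σ) * τ := by
    nlinarith
  have e11 := mul_le_mul_of_nonneg_left e10 hTc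
  linarith

/-- **Lemma 7.1 (Lemma E).** If `H` satisfies `A(δ)` and `R(δ,K)` (for suitable
`δ` depending on `σ`), then `H` satisfies `E(σ)`. -/
theorem lemma_E (r : ℕ) (hr : 3 ≤ r) (ε : ℝ) (hε : 0 < ε) (K : ℝ) (hK : 1 ≤ K) :
    ∀ σ : ℝ, 0 < σ → ∃ δ : ℝ, 0 < δ ∧ ∃ n₀ : ℕ, ∀ n : ℕ, n₀ ≤ n → r ∣ n →
      ∀ m : ℕ, (1 + ε) * ((n : ℝ) / r) * Real.log n < m → m ≤ n.choose r →
      ∀ H : Finset (Finset ℕ), H ⊆ Kn n r → H.card = m →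
        propA r n H δ → propR r (Finset.range n) H δ K →
        propE r (Finset.range n) H σ := by
  intro σ hσ
  have hrR : (3:ℝ) ≤ r := by exact_mod_cast hr
  have hr0 : (0:ℝ) < r := by linarith
  obtain ⟨τ, hτ, hτσ, hτ5⟩ : ∃ τ : ℝ, 0 < τ ∧ 4 * τ ≤ σ ∧ 4 * τ ≤ 1 := by
    refine ⟨min σ 1 / 4, by positivity, ?_, ?_⟩
    · have := min_le_left σ 1
      linarith
    · have := min_le_right σ 1
      linarith
  obtain ⟨η, hηdef⟩ : ∃ η : ℝ, η = σ ^ 2 * τ / (4 * r) := ⟨_, rfl⟩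
  have hη : 0 < η := by rw [hηdef]; positivity
  have haN : 0 < r * (r - 1) := Nat.mul_pos (by omega) (by omega)
  have haR : (0:ℝ) < ((r * (r - 1) : ℕ) : ℝ) := by exact_mod_cast haN
  obtain ⟨s0, hs0def⟩ : ∃ s0 : ℝ, s0 = η / (4 * ((r * (r - 1) : ℕ) : ℝ)) := ⟨_, rfl⟩
  have hs0 : 0 < s0 := by rw [hs0def]; positivity
  have hs0' : ((r * (r - 1) : ℕ) : ℝ) * s0 = η / 4 := by
    rw [hs0def]; field_simp
  obtain ⟨q, hqdef⟩ : ∃ q : ℝ, q = s0 ^ (r * (r - 1)) := ⟨_, rfl⟩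
  have hq : 0 < q := by rw [hqdef]; positivity
  obtain ⟨δ, hδ, hδ1, hδ2⟩ : ∃ δ : ℝ, 0 < δ ∧ δ ≤ η / 4 ∧ 2 * (r:ℝ) ^ 2 * δ / q ≤ η / 4 := by
    refine ⟨min (η / 4) (η * q / (8 * (r:ℝ) ^ 2)), by positivity, min_le_left _ _, ?_⟩
    rw [div_le_iff₀ hq]
    have := min_le_right (η / 4) (η * q / (8 * (r:ℝ) ^ 2))
    rw [le_div_iff₀ (by positivity)] at this
    linarith
  refine ⟨δ, hδ, ?_⟩
  have ev1 : ∀ᶠ n : ℕ in Filter.atTop, Real.exp (r + r * η) ≤ Real.log n :=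
    (Real.tendsto_log_atTop.comp tendsto_natCast_atTop_atTop).eventually_ge_atTop _
  have ev2 : ∀ᶠ n : ℕ in Filter.atTop, Real.log n ≤ (η / 8) * n := by
    have h := (Real.isLittleO_log_id_atTop.bound (show 0 < η / 8 by positivity))
    have h' := (tendsto_natCast_atTop_atTop (R := ℝ)).eventually h
    filter_upwards [h'] with n hn
    have := le_trans (le_abs_self _) hn
    simpa using this
  have ev3 : ∀ᶠ n : ℕ in Filter.atTop, 8 / η ≤ (n:ℝ) :=
    (tendsto_natCast_atTop_atTop (R := ℝ)).eventually_ge_atTop _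
  obtain ⟨n₀, hn₀⟩ := Filter.eventually_atTop.1 ((ev1.and ev2).and (ev3.and (Filter.eventually_ge_atTop 1)))
  refine ⟨n₀, fun n hn hdvd m hm1 hm2 H hH hHm hA hR => ?_⟩
  obtain ⟨⟨hl1, hl2⟩, hl3, hn1⟩ := hn₀ n hn
  have hnR : (0:ℝ) < n := by exact_mod_cast hn1
  rw [div_le_iff₀ hη] at hl3
  obtain ⟨k, rfl⟩ := hdvd
  have hk : 1 ≤ k := by
    rcases Nat.eq_zero_or_pos k with h | h
    · subst h; omega
    · exact h
  have hkR : (0:ℝ) < k := by exact_mod_cast hk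
  have hncast : ((r * k : ℕ) : ℝ) = r * k := by push_cast; ring
  have hdk : ((r * k : ℕ) : ℝ) / r = k := by rw [hncast]; field_simp
  rw [hdk] at hm1
  subst hHm
  have hexp1 : 1 ≤ Real.exp (r + r * η) := Real.one_le_exp (by positivity)
  have hmpos : (0:ℝ) < H.card := by
    refine lt_trans ?_ hm1
    have : 0 < Real.log ((r * k : ℕ) : ℝ) := by linarith
    positivity
  have hmN : 0 < H.card := by exact_mod_cast hmpos
  have hDdef : avgDeg r (Finset.range (r * k)) H = r * H.card / ((r * k : ℕ) : ℝ) := by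
    rw [avgDeg, Finset.card_range]
  have hDk : avgDeg r (Finset.range (r * k)) H = H.card / k := by
    rw [hDdef, hncast]; field_simp
  have hDge : Real.exp (r + r * η) ≤ avgDeg r (Finset.range (r * k)) H := by
    rw [hDk, le_div_iff₀ hkR]
    have h0 : 0 < Real.log ((r * k : ℕ) : ℝ) := by linarith
    have h1 : Real.exp (r + r * η) * k ≤ Real.log ((r * k : ℕ) : ℝ) * k :=
      mul_le_mul_of_nonneg_right hl1 hkR.le
    have h2 : 0 < ε * (k * Real.log ((r * k : ℕ) : ℝ)) := by positivity
    nlinarith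
  have hD1 : 1 ≤ avgDeg r (Finset.range (r * k)) H := hexp1.trans hDge
  have hlogD : Real.log (avgDeg r (Finset.range (r * k)) H) = Real.log H.card - Real.log k := by
    rw [hDk, Real.log_div hmpos.ne' hkR.ne']
  have hlogDge : (r:ℝ) + r * η ≤ Real.log (avgDeg r (Finset.range (r * k)) H) := by
    rw [Real.le_log_iff_exp_le (by linarith)]; exact hDge
  have hlow0 := A_lower (by omega) hk hmN hm2 hA
  rw [← hlogD] at hlow0
  have hlogk : Real.log k ≤ Real.log ((r * k : ℕ) : ℝ) := by
    apply Real.log_le_log hkR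
    exact_mod_cast Nat.le_mul_of_pos_left k (by omega)
  have hlow : (((r * k : ℕ) : ℝ) / r) * (Real.log (avgDeg r (Finset.range (r * k)) H) - (r - 1))
      - (η / 2) * ((r * k : ℕ) : ℝ) ≤ Real.log (pmCount (Finset.range (r * k)) H) := by
    rw [hdk]
    have h1 : δ * (r * k) ≤ η / 4 * ((r * k : ℕ) : ℝ) := by
      rw [hncast]
      exact mul_le_mul_of_nonneg_right hδ1 (by positivity)
    linarith
  have hΦ : (0:ℝ) < pmCount (Finset.range (r * k)) H := by
    rcases Nat.eq_zero_or_pos (pmCount (Finset.range (r * k)) H) with h | h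
    · exfalso
      rw [h, hdk, hncast] at hlow
      simp only [Nat.cast_zero, Real.log_zero] at hlow
      have h1 : (k:ℝ) * (1 + r * η)
          ≤ k * (Real.log (avgDeg r (Finset.range (r * k)) H) - (r - 1)) :=
        mul_le_mul_of_nonneg_left (by linarith) hkR.le
      have h2 : 0 < (r:ℝ) * k * η := by positivity
      nlinarith
    · exact_mod_cast h
  have hcore := core (n := r * k) (by omega) (by omega : 2 ≤ r) hH hδ.le hmN hR.2.2 hD1 hs0 hlow
    (η := η) (by rw [← hqdef, hs0']; linarith)
  have hS := dev_S (fun A => (phiSub (Finset.range (r * k)) H A : ℝ)) hmN hΦ hnR hr0 hDdef hτ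
    (by linarith) hσ hτσ hτ5 hcore
  have hT := dev_T (fun A => (phiSub (Finset.range (r * k)) H A : ℝ)) (fun A => Nat.cast_nonneg _)
    hmN hη.le hΦ hnR hr0 hDdef hτ (by linarith) hσ hτσ (sum_phi (by omega) hH) hcore
  have hrhs : (r:ℝ) * H.card * η = (σ * H.card / 2) * (τ * σ / 2) := by
    rw [hηdef]; field_simp; ring
  rw [hrhs] at hS hT
  have hτσ2 : 0 < τ * σ / 2 := by positivity
  have hS' := le_of_mul_le_mul_right hS hτσ2
  have hT' := le_of_mul_le_mul_right hT hτσ2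
  unfold propE
  have hsub : H.filter (fun A =>
      ¬((1 - σ) * (pmCount (Finset.range (r * k)) H : ℝ) / avgDeg r (Finset.range (r * k)) H
          ≤ (phiSub (Finset.range (r * k)) H A : ℝ) ∧
        (phiSub (Finset.range (r * k)) H A : ℝ)
          ≤ (1 + σ) * (pmCount (Finset.range (r * k)) H : ℝ) / avgDeg r (Finset.range (r * k)) H))
      ⊆ H.filter (fun A => (1 + σ) * (pmCount (Finset.range (r * k)) H : ℝ)
          / avgDeg r (Finset.range (r * k)) H < (phiSub (Finset.range (r * k)) H A : ℝ))
        ∪ H.filter (fun A => (phiSub (Finset.range (r * k)) H A : ℝ)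
          < (1 - σ) * (pmCount (Finset.range (r * k)) H : ℝ)
            / avgDeg r (Finset.range (r * k)) H) := by
    intro A hA'
    rw [mem_filter, not_and_or, not_le, not_le] at hA'
    rw [mem_union, mem_filter, mem_filter]
    tauto
  have hc : ((H.filter (fun A =>
      ¬((1 - σ) * (pmCount (Finset.range (r * k)) H : ℝ) / avgDeg r (Finset.range (r * k)) H
          ≤ (phiSub (Finset.range (r * k)) H A : ℝ) ∧
        (phiSub (Finset.range (r * k)) H A : ℝ)
          ≤ (1 + σ) * (pmCount (Finset.range (r * k)) H : ℝ)
            / avgDeg r (Finset.range (r * k)) H))).card : ℝ) ≤ _ :=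
    Nat.cast_le.2 ((card_le_card hsub).trans (card_union_le _ _))
  rw [Nat.cast_add] at hc
  linarith
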